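/- Let f₀ ∈ X_{0,1} be non-negative and suppose the kernel K is non-negative, symmetric, satisfies K(ς,ϱ) = r(ς)r(ϱ) + α(ς,ϱ) with r ∈ C((0,∞);[0,∞)), α ∈ C((0,∞)²;[0,∞)) symmetric, 0 ≤ α(ς,ϱ) ≤ A r(ς)r(ϱ) for (ς,ϱ) ∈ [1,∞)², and is strictly subquadratic: for each R ≥ 1, sup_{ς∈[0,R]} K(ς,ϱ)/ϱ → 0 as ϱ → ∞. Then there exists at least one mild solution f : [0,∞) → X_{0,1}⁺ of the continuous Redner–Ben-Avraham–Kahng coagulation equation ∂f/∂τ = ∫₀^∞ K(ς+ϱ,ϱ) f(ς+ϱ,τ) f(ϱ,τ) dϱ − ∫₀^∞ K(ς,ϱ) f(ς,τ) f(ϱ,τ) dϱ with f(·,0) = f₀, and this solution satisfies ∫₀^∞ ς f(ς,τ) dς ≤ ∫₀^∞ ς f₀(ς) dς for all τ ≥ 0. -/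

import Mathlib

open MeasureTheory

/-- `f : [0,∞) → X_{0,1}⁺` (represented as `f ς τ`) is a mild solution of the continuous
Redner–Ben-Avraham–Kahng coagulation equation with kernel `K` and initial datum `f₀`. -/
def IsMildSolutionRBK (K : ℝ → ℝ → ℝ) (f₀ : ℝ → ℝ) (f : ℝ → ℝ → ℝ) : Prop :=
  Measurable (Function.uncurry f) ∧
  -- non-negativity (values in the positive cone X_{0,1}⁺)
  (∀ ς > (0:ℝ), ∀ τ ≥ (0:ℝ), 0 ≤ f ς τ) ∧
  -- f ∈ C([0,∞); L¹(0,∞))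
  (∀ τ₀ ≥ (0:ℝ), Filter.Tendsto (fun τ => ∫ ς in Set.Ioi (0:ℝ), |f ς τ - f ς τ₀|)
      (nhdsWithin τ₀ (Set.Ici 0)) (nhds 0)) ∧
  -- f ∈ L^∞(0,T; X_{0,1}) for every T
  (∀ T > (0:ℝ), ∃ C : ℝ, ∀ τ ∈ Set.Icc 0 T,
      IntegrableOn (fun ς => (1 + ς) * f ς τ) (Set.Ioi 0) ∧
      ∫ ς in Set.Ioi (0:ℝ), (1 + ς) * f ς τ ≤ C) ∧
  -- integrability of the collision integrand
  (∀ τ > (0:ℝ), ∀ᵐ ς ∂(volume.restrict (Set.Ioi 0)),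
      IntegrableOn (fun p : ℝ × ℝ => K ς p.1 * f ς p.2 * f p.1 p.2)
        (Set.Ioi 0 ×ˢ Set.Ioc 0 τ)) ∧
  -- the mild (integral) equation
  (∀ τ ≥ (0:ℝ), ∀ᵐ ς ∂(volume.restrict (Set.Ioi 0)),
      f ς τ = f₀ ς
        + (∫ s in Set.Ioc (0:ℝ) τ, ∫ ϱ in Set.Ioi (0:ℝ),
            K (ς + ϱ) ϱ * f (ς + ϱ) s * f ϱ s)
        - ∫ s in Set.Ioc (0:ℝ) τ, ∫ ϱ in Set.Ioi (0:ℝ), K ς ϱ * f ς s * f ϱ s)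

open Set Filter Topology
open scoped ENNReal NNReal

/-- A measurable symmetric collision rate on `(0,∞)²`, extended by zero. -/
structure IsCollisionKernel (k : ℝ × ℝ → ℝ≥0∞) : Prop where
  measurable : Measurable k
  symm : ∀ x y, k (x, y) = k (y, x)
  eq_zero : ∀ x y, x ≤ 0 → k (x, y) = 0

lemma IsCollisionKernel.eq_zero_right {k : ℝ × ℝ → ℝ≥0∞} (hk : IsCollisionKernel k) (x y : ℝ)
    (hy : y ≤ 0) : k (x, y) = 0 := by
  rw [hk.symm, hk.eq_zero _ _ hy]

/-- One explicit Euler step, of length `Δ`, for the measure-valued coagulation equation. -/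
noncomputable def eulerStep (k : ℝ × ℝ → ℝ≥0∞) (Δ : ℝ≥0∞) (μ : Measure ℝ) : Measure ℝ :=
  μ.withDensity (fun x => 1 - Δ * ∫⁻ y, k (x, y) ∂μ) +
    (Δ / 2) • ((μ.prod μ).withDensity k).map (fun p => |p.1 - p.2|)

lemma lintegral_eulerStep_add {k : ℝ × ℝ → ℝ≥0∞} (hk : IsCollisionKernel k) {Δ : ℝ≥0∞}
    {μ : Measure ℝ} [SFinite μ] (hΔ : ∀ x, Δ * ∫⁻ y, k (x, y) ∂μ ≤ 1) {h : ℝ → ℝ≥0∞}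
    (hh : Measurable h) :
    ∫⁻ x, h x ∂(eulerStep k Δ μ) + Δ * ∫⁻ p, h p.1 * k p ∂(μ.prod μ)
      = ∫⁻ x, h x ∂μ + Δ / 2 * ∫⁻ p, h |p.1 - p.2| * k p ∂(μ.prod μ) := by
  have hkm := hk.measurable
  have hL : Measurable (fun x => ∫⁻ y, k (x, y) ∂μ) := hkm.lintegral_prod_right'
  have habs : Measurable (fun p : ℝ × ℝ => |p.1 - p.2|) := by fun_prop
  rw [eulerStep, lintegral_add_measure, lintegral_smul_measure, lintegral_map hh habs,
    lintegral_withDensity_eq_lintegral_mul _ hkm (g := fun p => h |p.1 - p.2|) (hh.comp habs),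
    lintegral_withDensity_eq_lintegral_mul _ (by fun_prop) hh, smul_eq_mul]
  have h1 : Δ * ∫⁻ p, h p.1 * k p ∂(μ.prod μ)
      = ∫⁻ x, (Δ * ∫⁻ y, k (x, y) ∂μ) * h x ∂μ := by
    rw [lintegral_prod _ (by fun_prop), ← lintegral_const_mul _ (by fun_prop)]
    congr 1 with x
    dsimp only
    rw [lintegral_const_mul _ (by fun_prop)]
    ring
  rw [h1, add_right_comm, ← lintegral_add_left (by fun_prop)]
  congr 1
  · congr 1 with x
    simp only [Pi.mul_apply]
    rw [← add_mul, tsub_add_cancel_of_le (hΔ x), one_mul]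
  · congr 2 with p
    simp [mul_comm]

lemma lintegral_symm_kernel {k : ℝ × ℝ → ℝ≥0∞} (hk : IsCollisionKernel k)
    {μ : Measure ℝ} [SFinite μ] (g : ℝ × ℝ → ℝ≥0∞) :
    ∫⁻ p, g p.swap * k p ∂(μ.prod μ) = ∫⁻ p, g p * k p ∂(μ.prod μ) := by
  rw [← lintegral_prod_swap]
  congr 1 with p
  rw [Prod.swap_swap]
  congr 1
  exact hk.symm _ _

lemma lintegral_eulerStep_le {k : ℝ × ℝ → ℝ≥0∞} (hk : IsCollisionKernel k) {Δ : ℝ≥0∞}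
    (hΔt : Δ ≠ ∞) {μ : Measure ℝ} [SFinite μ] (hΔ : ∀ x, Δ * ∫⁻ y, k (x, y) ∂μ ≤ 1)
    {h : ℝ → ℝ≥0∞} (hh : Measurable h) {ψ : ℝ × ℝ → ℝ≥0∞} (hψ : Measurable ψ)
    (hfin : ∫⁻ p, h p.1 * k p ∂(μ.prod μ) ≠ ∞) :
    ((∀ x > 0, ∀ y > 0, h |x - y| + 2 * ψ (x, y) ≤ h x + h y) →
      ∫⁻ x, h x ∂(eulerStep k Δ μ) + Δ * ∫⁻ p, ψ p * k p ∂(μ.prod μ) ≤ ∫⁻ x, h x ∂μ) ∧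
    ((∀ x > 0, ∀ y > 0, h |x - y| + 2 * ψ (x, y) = h x + h y) →
      ∫⁻ x, h x ∂(eulerStep k Δ μ) + Δ * ∫⁻ p, ψ p * k p ∂(μ.prod μ) = ∫⁻ x, h x ∂μ) := by
  have hkm := hk.measurable
  have key := lintegral_eulerStep_add hk hΔ hh
  have hs : ∫⁻ p, h p.2 * k p ∂(μ.prod μ) = ∫⁻ p, h p.1 * k p ∂(μ.prod μ) :=
    lintegral_symm_kernel hk (fun p => h p.1)
  have h2 : ∫⁻ p, (h p.1 + h p.2) * k p ∂(μ.prod μ) = 2 * ∫⁻ p, h p.1 * k p ∂(μ.prod μ) := by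
    simp_rw [add_mul]
    rw [lintegral_add_left (by fun_prop), hs, two_mul]
  have h3 : ∫⁻ p, (h |p.1 - p.2| + 2 * ψ p) * k p ∂(μ.prod μ)
      = ∫⁻ p, h |p.1 - p.2| * k p ∂(μ.prod μ) + 2 * ∫⁻ p, ψ p * k p ∂(μ.prod μ) := by
    simp_rw [add_mul, mul_assoc]
    rw [lintegral_add_left (by fun_prop), lintegral_const_mul _ (by fun_prop)]
  have hhalf : ∀ z : ℝ≥0∞, Δ / 2 * (2 * z) = Δ * z := fun z => by
    rw [← mul_assoc, ENNReal.div_mul_cancel (by simp) (by simp)]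
  have hb : Δ * ∫⁻ p, h p.1 * k p ∂(μ.prod μ) ≠ ∞ := ENNReal.mul_ne_top hΔt hfin
  have e1 : ∫⁻ x, h x ∂(eulerStep k Δ μ) + Δ * ∫⁻ p, ψ p * k p ∂(μ.prod μ)
        + Δ * ∫⁻ p, h p.1 * k p ∂(μ.prod μ)
      = ∫⁻ x, h x ∂μ + Δ / 2 * ∫⁻ p, (h |p.1 - p.2| + 2 * ψ p) * k p ∂(μ.prod μ) := by
    rw [add_right_comm, key, h3, mul_add, hhalf, add_assoc]
  constructor
  · intro H
    have : ∫⁻ p, (h |p.1 - p.2| + 2 * ψ p) * k p ∂(μ.prod μ)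
        ≤ ∫⁻ p, (h p.1 + h p.2) * k p ∂(μ.prod μ) := by
      refine lintegral_mono fun p => ?_
      obtain ⟨x, y⟩ := p
      rcases le_or_gt x 0 with hx | hx
      · simp [hk.eq_zero _ _ hx]
      rcases le_or_gt y 0 with hy | hy
      · simp [hk.eq_zero_right _ _ hy]
      exact mul_le_mul_left (H x hx y hy) _
    rw [← ENNReal.add_le_add_iff_right hb, e1]
    rw [h2] at this
    calc _ ≤ ∫⁻ x, h x ∂μ + Δ / 2 * (2 * ∫⁻ p, h p.1 * k p ∂(μ.prod μ)) := by gcongr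
      _ = _ := by rw [hhalf]
  · intro H
    have : ∫⁻ p, (h |p.1 - p.2| + 2 * ψ p) * k p ∂(μ.prod μ)
        = ∫⁻ p, (h p.1 + h p.2) * k p ∂(μ.prod μ) := by
      refine lintegral_congr fun p => ?_
      obtain ⟨x, y⟩ := p
      rcases le_or_gt x 0 with hx | hx
      · simp [hk.eq_zero _ _ hx]
      rcases le_or_gt y 0 with hy | hy
      · simp [hk.eq_zero_right _ _ hy]
      rw [H x hx y hy]
    rw [← ENNReal.add_left_inj hb, e1, this, h2, hhalf]

/-- The iterates of the explicit Euler scheme. -/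
noncomputable def eulerSeq (k : ℝ × ℝ → ℝ≥0∞) (Δ : ℝ≥0∞) (μ : Measure ℝ) (j : ℕ) : Measure ℝ :=
  (eulerStep k Δ)^[j] μ

lemma eulerSeq_succ (k : ℝ × ℝ → ℝ≥0∞) (Δ : ℝ≥0∞) (μ : Measure ℝ) (j : ℕ) :
    eulerSeq k Δ μ (j + 1) = eulerStep k Δ (eulerSeq k Δ μ j) :=
  Function.iterate_succ_apply' _ _ _

section EulerSeq

variable {k : ℝ × ℝ → ℝ≥0∞} {Δ c : ℝ≥0∞} {μ : Measure ℝ}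

lemma step_mul_lintegral_le_one (hc : ∀ p, k p ≤ c) (hΔ : Δ * (c * μ univ) ≤ 1)
    {ν : Measure ℝ} (hν : ν univ ≤ μ univ) (x : ℝ) : Δ * ∫⁻ y, k (x, y) ∂ν ≤ 1 := by
  refine le_trans ?_ hΔ
  gcongr
  calc ∫⁻ y, k (x, y) ∂ν ≤ ∫⁻ _, c ∂ν := lintegral_mono fun y => hc _
    _ = c * ν univ := lintegral_const c
    _ ≤ _ := by gcongr

lemma lintegral_fst_mul_kernel_ne_top (hc : ∀ p, k p ≤ c) (hct : c ≠ ∞) {ν : Measure ℝ}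
    [IsFiniteMeasure ν] {h : ℝ → ℝ≥0∞} (hh : Measurable h) (hfin : ∫⁻ x, h x ∂ν ≠ ∞) :
    ∫⁻ p, h p.1 * k p ∂(ν.prod ν) ≠ ∞ := by
  have : ∫⁻ p, h p.1 * k p ∂(ν.prod ν) ≤ ∫⁻ p, h p.1 * c ∂(ν.prod ν) :=
    lintegral_mono fun p => by dsimp only; gcongr; exact hc p
  refine ne_top_of_le_ne_top ?_ this
  rw [lintegral_prod _ (by fun_prop)]
  simp only [lintegral_const]
  rw [lintegral_mul_const _ (by fun_prop), lintegral_mul_const _ (by fun_prop)]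
  exact ENNReal.mul_ne_top (ENNReal.mul_ne_top hfin hct) (measure_ne_top _ _)

lemma eulerSeq_univ_le [IsFiniteMeasure μ] (hk : IsCollisionKernel k) (hΔt : Δ ≠ ∞)
    (hct : c ≠ ∞) (hc : ∀ p, k p ≤ c) (hΔ : Δ * (c * μ univ) ≤ 1) (j : ℕ) :
    eulerSeq k Δ μ j univ ≤ μ univ := by
  induction j with
  | zero => exact le_rfl
  | succ j ih =>
    have : IsFiniteMeasure (eulerSeq k Δ μ j) := ⟨ih.trans_lt (measure_lt_top _ _)⟩
    have := (lintegral_eulerStep_le hk hΔt (step_mul_lintegral_le_one hc hΔ ih)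
      (h := fun _ => 1) measurable_const (ψ := fun _ => 0) measurable_const
      (lintegral_fst_mul_kernel_ne_top hc hct measurable_const (by simp))).1
      (fun x _ y _ => by simp)
    rw [eulerSeq_succ]
    simp only [zero_mul, lintegral_zero, mul_zero, add_zero, lintegral_one] at this
    exact this.trans ih

lemma lintegral_eulerSeq [IsFiniteMeasure μ] (hk : IsCollisionKernel k) (hΔt : Δ ≠ ∞)
    (hct : c ≠ ∞) (hc : ∀ p, k p ≤ c) (hΔ : Δ * (c * μ univ) ≤ 1)
    {h : ℝ → ℝ≥0∞} (hh : Measurable h) {ψ : ℝ × ℝ → ℝ≥0∞} (hψ : Measurable ψ)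
    (hfin : ∫⁻ x, h x ∂μ ≠ ∞)
    (H : ∀ x > 0, ∀ y > 0, h |x - y| + 2 * ψ (x, y) ≤ h x + h y) (j : ℕ) :
    (∫⁻ x, h x ∂(eulerSeq k Δ μ j) + ∑ i ∈ Finset.range j,
        Δ * ∫⁻ p, ψ p * k p ∂((eulerSeq k Δ μ i).prod (eulerSeq k Δ μ i)) ≤ ∫⁻ x, h x ∂μ) ∧
    ((∀ x > 0, ∀ y > 0, h |x - y| + 2 * ψ (x, y) = h x + h y) →
      ∫⁻ x, h x ∂(eulerSeq k Δ μ j) + ∑ i ∈ Finset.range j,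
        Δ * ∫⁻ p, ψ p * k p ∂((eulerSeq k Δ μ i).prod (eulerSeq k Δ μ i)) = ∫⁻ x, h x ∂μ) := by
  induction j with
  | zero => simp [eulerSeq]
  | succ j ih =>
    have hm := eulerSeq_univ_le hk hΔt hct hc hΔ j
    have : IsFiniteMeasure (eulerSeq k Δ μ j) := ⟨hm.trans_lt (measure_lt_top _ _)⟩
    have hf : ∫⁻ x, h x ∂(eulerSeq k Δ μ j) ≠ ∞ :=
      ne_top_of_le_ne_top hfin (le_self_add.trans ih.1)
    have hstep := lintegral_eulerStep_le hk hΔt (step_mul_lintegral_le_one hc hΔ hm) hh hψ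
      (lintegral_fst_mul_kernel_ne_top hc hct hh hf)
    rw [Finset.sum_range_succ, eulerSeq_succ, add_comm (∑ i ∈ Finset.range j, _), ← add_assoc]
    refine ⟨le_trans ?_ ih.1, fun H' => ?_⟩
    · gcongr
      exact hstep.1 H
    · rw [hstep.2 H', ih.2 H']

end EulerSeq

lemma restrict_Ioi_ext {μ ν : Measure ℝ} [IsFiniteMeasure μ] [IsFiniteMeasure ν]
    (h : ∀ a > 0, μ (Ioi a) = ν (Ioi a)) : μ.restrict (Ioi 0) = ν.restrict (Ioi 0) := by
  have hU : (Ioi (0 : ℝ)) = ⋃ n : ℕ, Ioi (1 / ((n : ℝ) + 1)) := by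
    ext x
    simp only [mem_Ioi, mem_iUnion]
    exact ⟨fun hx => exists_nat_one_div_lt hx, fun ⟨n, hn⟩ => lt_trans (by positivity) hn⟩
  have hmono : Monotone (fun n : ℕ => Ioi (1 / ((n : ℝ) + 1))) := fun m n hmn =>
    Ioi_subset_Ioi (Nat.one_div_le_one_div hmn)
  have h0 : μ (Ioi 0) = ν (Ioi 0) := by
    rw [hU, hmono.measure_iUnion, hmono.measure_iUnion]
    exact iSup_congr fun n => h _ (by positivity)
  have hall : ∀ a, μ (Ioi a ∩ Ioi 0) = ν (Ioi a ∩ Ioi 0) := by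
    intro a
    rw [Ioi_inter_Ioi]
    rcases le_or_gt a 0 with ha | ha
    · rw [sup_of_le_right ha, h0]
    · rw [sup_of_le_left ha.le, h a ha]
  refine ext_of_generate_finite _ (BorelSpace.measurable_eq.trans (borel_eq_generateFrom_Ioi ℝ))
    isPiSystem_Ioi ?_ ?_
  · rintro _ ⟨a, rfl⟩
    rw [Measure.restrict_apply measurableSet_Ioi, Measure.restrict_apply measurableSet_Ioi, hall]
  · simp [h0]

/-- The decreasing rearrangement of a measure on the half-line: the size of the largest
particles that remain after discarding a number `u` of them. -/
noncomputable def quant (μ : Measure ℝ) (u : ℝ) : ℝ≥0∞ :=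
  ⨆ (x : ℝ) (_ : 0 ≤ x) (_ : ENNReal.ofReal u < μ (Ioi x)), ENNReal.ofReal x

lemma ofReal_lt_quant_iff {μ : Measure ℝ} {u a : ℝ} (ha : 0 ≤ a) :
    ENNReal.ofReal a < quant μ u ↔ ENNReal.ofReal u < μ (Ioi a) := by
  constructor
  · intro h
    simp only [quant, lt_iSup_iff] at h
    obtain ⟨x, _, hux, hax⟩ := h
    refine hux.trans_le (measure_mono (Ioi_subset_Ioi ?_))
    by_contra! hxa
    exact absurd hax (not_lt.2 (ENNReal.ofReal_le_ofReal hxa.le))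
  · intro h
    have hU : (Ioi a) = ⋃ n : ℕ, Ioi (a + 1 / ((n : ℝ) + 1)) := by
      ext x
      simp only [mem_Ioi, mem_iUnion]
      constructor
      · intro hx
        obtain ⟨n, hn⟩ := exists_nat_one_div_lt (sub_pos.2 hx)
        exact ⟨n, by linarith⟩
      · rintro ⟨n, hn⟩
        have : (0 : ℝ) < 1 / ((n : ℝ) + 1) := by positivity
        linarith
    have hmono : Monotone (fun n : ℕ => Ioi (a + 1 / ((n : ℝ) + 1))) := fun m n hmn =>
      Ioi_subset_Ioi (by gcongr)
    rw [hU, hmono.measure_iUnion, lt_iSup_iff] at h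
    obtain ⟨n, hn⟩ := h
    have hpos : (0 : ℝ) < 1 / ((n : ℝ) + 1) := by positivity
    refine lt_of_lt_of_le ((ENNReal.ofReal_lt_ofReal_iff (by linarith)).2
      (lt_add_of_pos_right a hpos)) ?_
    exact le_iSup_of_le _ (le_iSup_of_le (by linarith) (le_iSup_of_le hn le_rfl))

lemma quant_antitone (μ : Measure ℝ) : Antitone (quant μ) := fun _ _ huv =>
  iSup_mono fun _ => iSup_mono fun _ => iSup_mono' fun h =>
    ⟨(ENNReal.ofReal_le_ofReal huv).trans_lt h, le_rfl⟩

lemma quant_mono {μ ν : Measure ℝ} (h : ∀ a ≥ 0, μ (Ioi a) ≤ ν (Ioi a)) (u : ℝ) :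
    quant μ u ≤ quant ν u :=
  iSup_mono fun _ => iSup_mono fun hx => iSup_mono' fun h' => ⟨h'.trans_le (h _ hx), le_rfl⟩

lemma quant_ne_top {μ : Measure ℝ} [IsFiniteMeasure μ] {u : ℝ} (hu : 0 < u) :
    quant μ u ≠ ∞ := by
  intro htop
  have h1 : ∀ n : ℕ, ENNReal.ofReal u ≤ μ (Ioi (n : ℝ)) := fun n =>
    ((ofReal_lt_quant_iff (Nat.cast_nonneg n)).1 (htop ▸ ENNReal.ofReal_lt_top)).le
  have h2 : Tendsto (fun n : ℕ => μ (Ioi (n : ℝ))) atTop (𝓝 (μ (⋂ n : ℕ, Ioi (n : ℝ)))) :=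
    tendsto_measure_iInter_atTop (fun n => measurableSet_Ioi.nullMeasurableSet)
      (fun m n hmn => Ioi_subset_Ioi (Nat.cast_le.2 hmn)) ⟨0, measure_ne_top _ _⟩
  have h3 : (⋂ n : ℕ, Ioi (n : ℝ)) = ∅ := by
    ext x
    simp only [mem_iInter, mem_Ioi, mem_empty_iff_false, iff_false, not_forall, not_lt]
    exact exists_nat_ge x
  rw [h3, measure_empty] at h2
  have := ge_of_tendsto' h2 h1
  simp at this
  linarith

lemma measurable_quant (μ : Measure ℝ) : Measurable (quant μ) := (quant_antitone μ).measurable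

lemma lintegral_quant {μ : Measure ℝ} [IsFiniteMeasure μ] {N : ℝ}
    (hN : μ univ ≤ ENNReal.ofReal N) {h : ℝ → ℝ≥0∞} (hh : Measurable h)
    (h0 : ∀ x ≤ 0, h x = 0) :
    ∫⁻ u in Ioc 0 N, h (quant μ u).toReal = ∫⁻ x, h x ∂μ := by
  have hq : Measurable (fun u => (quant μ u).toReal) := (measurable_quant μ).ennreal_toReal
  have hsupp : ∀ ν : Measure ℝ, ∫⁻ x, h x ∂ν = ∫⁻ x, h x ∂(ν.restrict (Ioi 0)) := by
    intro ν
    rw [← lintegral_indicator measurableSet_Ioi]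
    congr 1 with x
    by_cases hx : 0 < x
    · simp [hx]
    · simp [hx, h0 x (not_lt.1 hx)]
  have hext : (((volume.restrict (Ioc 0 N)).map (fun u => (quant μ u).toReal))).restrict (Ioi 0)
      = μ.restrict (Ioi 0) := by
    refine restrict_Ioi_ext fun a ha => ?_
    rw [Measure.map_apply hq measurableSet_Ioi,
      Measure.restrict_apply (hq measurableSet_Ioi)]
    have hle : (μ (Ioi a)).toReal ≤ max N 0 := by
      refine ENNReal.toReal_le_of_le_ofReal (le_max_right _ _)
        (((measure_mono (subset_univ _)).trans hN).trans
          (ENNReal.ofReal_le_ofReal (le_max_left _ _)))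
    have : ((fun u => (quant μ u).toReal) ⁻¹' Ioi a) ∩ Ioc 0 N = Ioo 0 (μ (Ioi a)).toReal := by
      ext u
      simp only [mem_inter_iff, mem_preimage, mem_Ioi, mem_Ioc, mem_Ioo]
      have key : 0 < u → (a < (quant μ u).toReal ↔ u < (μ (Ioi a)).toReal) := by
        intro hu
        rw [← ENNReal.ofReal_lt_iff_lt_toReal ha.le (quant_ne_top hu), ofReal_lt_quant_iff ha.le,
          ENNReal.ofReal_lt_iff_lt_toReal hu.le (measure_ne_top _ _)]
      constructor
      · rintro ⟨h1, h2, h3⟩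
        exact ⟨h2, (key h2).1 h1⟩
      · rintro ⟨h1, h2⟩
        refine ⟨(key h1).2 h2, h1, ?_⟩
        rcases le_max_iff.1 (h2.le.trans hle) with h | h
        · exact h
        · linarith
    rw [this, Real.volume_Ioo, sub_zero, ENNReal.ofReal_toReal (measure_ne_top _ _)]
  rw [← lintegral_map hh hq, hsupp, hext, ← hsupp]

lemma lintegral_prod_quant {μ : Measure ℝ} [IsFiniteMeasure μ] {N : ℝ}
    (hN : μ univ ≤ ENNReal.ofReal N) {g : ℝ × ℝ → ℝ≥0∞} (hg : Measurable g)
    (h1 : ∀ x y, x ≤ 0 → g (x, y) = 0) (h2 : ∀ x y, y ≤ 0 → g (x, y) = 0) :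
    ∫⁻ p, g ((quant μ p.1).toReal, (quant μ p.2).toReal)
        ∂((volume.restrict (Ioc 0 N)).prod (volume.restrict (Ioc 0 N)))
      = ∫⁻ p, g p ∂(μ.prod μ) := by
  have hq : Measurable (fun u => (quant μ u).toReal) := (measurable_quant μ).ennreal_toReal
  have hgq : Measurable (fun p : ℝ × ℝ => g ((quant μ p.1).toReal, (quant μ p.2).toReal)) :=
    hg.comp ((hq.comp measurable_fst).prodMk (hq.comp measurable_snd))
  rw [lintegral_prod _ hgq.aemeasurable, lintegral_prod _ hg.aemeasurable,
    ← lintegral_quant hN (h := fun x => ∫⁻ y, g (x, y) ∂μ) hg.lintegral_prod_right'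
      (fun x hx => by simp [h1 x _ hx])]
  congr 1 with u
  exact lintegral_quant hN (h := fun y => g ((quant μ u).toReal, y)) (by fun_prop)
    (fun y hy => h2 _ y hy)

lemma lintegral_floor {Δ : ℝ} (hΔ : 0 < Δ) (a : ℕ → ℝ≥0∞) (j : ℕ) :
    ∫⁻ s in Ico 0 (Δ * j), a ⌊s / Δ⌋₊ = ∑ i ∈ Finset.range j, ENNReal.ofReal Δ * a i := by
  induction j with
  | zero => simp
  | succ j ih =>
    have h1 : (0 : ℝ) ≤ Δ * j := by positivity
    have h2 : Δ * j ≤ Δ * (j + 1 : ℕ) := by gcongr; simp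
    rw [← Ico_union_Ico_eq_Ico h1 h2, lintegral_union measurableSet_Ico Ico_disjoint_Ico_same, ih,
      Finset.sum_range_succ]
    congr 1
    have : ∀ s ∈ Ico (Δ * j) (Δ * (j + 1 : ℕ)), a ⌊s / Δ⌋₊ = a j := by
      intro s hs
      congr 1
      rw [Nat.floor_eq_iff (div_nonneg (h1.trans hs.1) hΔ.le)]
      constructor
      · rw [le_div_iff₀ hΔ]; linarith [hs.1]
      · rw [div_lt_iff₀ hΔ]; have := hs.2; push_cast at this; linarith
    rw [setLIntegral_congr_fun measurableSet_Ico this, setLIntegral_const, Real.volume_Ico,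
      mul_comm]
    congr 2
    push_cast; ring

lemma measurable_comp_nat {F : ℕ → ℝ → ℝ≥0∞} (hF : ∀ j, Measurable (F j)) {n : ℝ → ℕ}
    (hn : Measurable n) : Measurable (fun q : ℝ × ℝ => F (n q.1) q.2) := by
  have h1 : Measurable (Function.uncurry F) := measurable_from_prod_countable_right hF
  exact h1.comp ((hn.comp measurable_fst).prodMk measurable_snd)

lemma measurable_quant_floor (ν : ℕ → Measure ℝ) (Δ : ℝ) :
    Measurable (fun q : ℝ × ℝ => quant (ν ⌊q.1 / Δ⌋₊) q.2) := by
  have hn : Measurable (fun t : ℝ => ⌊t / Δ⌋₊) := (measurable_id.div_const Δ).nat_floor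
  exact measurable_comp_nat (F := fun j => quant (ν j)) (n := fun t => ⌊t / Δ⌋₊)
    (fun j => measurable_quant (ν j)) hn

lemma lintegral_quant_floor {ν : ℕ → Measure ℝ} [∀ j, IsFiniteMeasure (ν j)] {N : ℝ}
    (hN : ∀ j, ν j univ ≤ ENNReal.ofReal N) {Δ : ℝ} (hΔ0 : 0 < Δ) {g : ℝ × ℝ → ℝ≥0∞}
    (hg : Measurable g) (h1 : ∀ x y, x ≤ 0 → g (x, y) = 0) (h2 : ∀ x y, y ≤ 0 → g (x, y) = 0)
    {t : ℝ} (ht : 0 ≤ t) {Y : ℝ → ℝ → ℝ≥0∞} (hYν : ∀ s u, Y s u = quant (ν ⌊s / Δ⌋₊) u) :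
    ∫⁻ ω, (Iio (Δ * ⌊t / Δ⌋₊)).indicator
        (fun s => g ((Y s ω.2.1).toReal, (Y s ω.2.2).toReal)) ω.1
      ∂((volume.restrict (Ico 0 t)).prod
        ((volume.restrict (Ioc 0 N)).prod (volume.restrict (Ioc 0 N))))
      = ∑ i ∈ Finset.range ⌊t / Δ⌋₊, ENNReal.ofReal Δ * ∫⁻ p, g p ∂((ν i).prod (ν i)) := by
  have hle : Δ * ⌊t / Δ⌋₊ ≤ t := by
    have := Nat.floor_le (div_nonneg ht hΔ0.le)
    rw [le_div_iff₀ hΔ0] at this; linarith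
  have hYm : Measurable (fun q : ℝ × ℝ => (Y q.1 q.2).toReal) := by
    simp_rw [hYν]; exact (measurable_quant_floor ν Δ).ennreal_toReal
  have hY1 : Measurable (fun ω : ℝ × ℝ × ℝ => (Y ω.1 ω.2.1).toReal) :=
    hYm.comp (measurable_fst.prodMk measurable_snd.fst)
  have hY2 : Measurable (fun ω : ℝ × ℝ × ℝ => (Y ω.1 ω.2.2).toReal) :=
    hYm.comp (measurable_fst.prodMk measurable_snd.snd)
  have hint : Measurable (fun ω : ℝ × ℝ × ℝ => g ((Y ω.1 ω.2.1).toReal, (Y ω.1 ω.2.2).toReal)) :=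
    hg.comp (hY1.prodMk hY2)
  have hind : Measurable (fun ω : ℝ × ℝ × ℝ => (Iio (Δ * ⌊t / Δ⌋₊)).indicator
      (fun s => g ((Y s ω.2.1).toReal, (Y s ω.2.2).toReal)) ω.1) :=
    hint.indicator (measurable_fst (measurableSet_Iio (a := Δ * ⌊t / Δ⌋₊)))
  have hI : Ico 0 (Δ * (⌊t / Δ⌋₊ : ℝ)) = Iio (Δ * (⌊t / Δ⌋₊ : ℝ)) ∩ Ico 0 t := by
    ext s; simp only [mem_Ico, mem_inter_iff, mem_Iio]
    constructor
    · rintro ⟨h1, h2⟩; exact ⟨h2, h1, h2.trans_le hle⟩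
    · rintro ⟨h1, h2, _⟩; exact ⟨h2, h1⟩
  rw [← lintegral_floor hΔ0, lintegral_prod _ hind.aemeasurable, hI,
    ← Measure.restrict_restrict measurableSet_Iio, ← lintegral_indicator measurableSet_Iio]
  congr 1 with s
  by_cases hs : s ∈ Iio (Δ * (⌊t / Δ⌋₊ : ℝ))
  · simp only [indicator_of_mem hs, hYν]
    exact lintegral_prod_quant (hN _) hg h1 h2
  · simp only [indicator_of_notMem hs, lintegral_zero]

/-- The time-dependent family of particle sizes produced by the Euler scheme, in the parametrisation
by the decreasing rearrangement. -/
lemma exists_euler_approx {k : ℝ × ℝ → ℝ≥0∞} (hk : IsCollisionKernel k) {c : ℝ≥0∞} (hct : c ≠ ∞)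
    (hc : ∀ p, k p ≤ c) {μ : Measure ℝ} [IsFiniteMeasure μ] {Δ : ℝ} (hΔ0 : 0 < Δ)
    (hΔ : ENNReal.ofReal Δ * (c * μ univ) ≤ 1) {m : Measure ℝ}
    (hm : m = volume.restrict (Ioc 0 (μ univ).toReal)) :
    ∃ Y : ℝ → ℝ → ℝ≥0∞, Measurable (Function.uncurry Y) ∧ (∀ u, Antitone fun t => Y t u) ∧
      (∀ t, Antitone (Y t)) ∧ (∀ t u, Y t u ≤ quant μ u) ∧
      ∀ (h : ℝ → ℝ≥0∞) (ψ : ℝ × ℝ → ℝ≥0∞), Measurable h → Measurable ψ → (∀ x ≤ 0, h x = 0) →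
        ∫⁻ x, h x ∂μ ≠ ∞ → (∀ x > 0, ∀ y > 0, h |x - y| + 2 * ψ (x, y) ≤ h x + h y) →
        ∀ t ≥ 0,
        (∫⁻ u, h (Y t u).toReal ∂m + ∫⁻ ω, (Iio (Δ * ⌊t / Δ⌋₊)).indicator
            (fun s => ψ ((Y s ω.2.1).toReal, (Y s ω.2.2).toReal) *
              k ((Y s ω.2.1).toReal, (Y s ω.2.2).toReal)) ω.1
            ∂((volume.restrict (Ico 0 t)).prod (m.prod m)) ≤ ∫⁻ x, h x ∂μ) ∧
        ((∀ x > 0, ∀ y > 0, h |x - y| + 2 * ψ (x, y) = h x + h y) →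
          ∫⁻ u, h (Y t u).toReal ∂m + ∫⁻ ω, (Iio (Δ * ⌊t / Δ⌋₊)).indicator
            (fun s => ψ ((Y s ω.2.1).toReal, (Y s ω.2.2).toReal) *
              k ((Y s ω.2.1).toReal, (Y s ω.2.2).toReal)) ω.1
            ∂((volume.restrict (Ico 0 t)).prod (m.prod m)) = ∫⁻ x, h x ∂μ) := by
  obtain ⟨D, hD⟩ : ∃ D, D = ENNReal.ofReal Δ := ⟨_, rfl⟩
  rw [← hD] at hΔ
  have hDt : D ≠ ∞ := hD ▸ ENNReal.ofReal_ne_top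
  obtain ⟨ν, hν⟩ : ∃ ν : ℕ → Measure ℝ, ν = eulerSeq k D μ := ⟨_, rfl⟩
  have hmass : ∀ j, ν j univ ≤ μ univ := hν ▸ eulerSeq_univ_le hk hDt hct hc hΔ
  have hfinν : ∀ j, IsFiniteMeasure (ν j) := fun j => ⟨(hmass j).trans_lt (measure_lt_top _ _)⟩
  have hmass' : ∀ j, ν j univ ≤ ENNReal.ofReal (μ univ).toReal := fun j => by
    rw [ENNReal.ofReal_toReal (measure_ne_top _ _)]; exact hmass j
  have hstep : ∀ j, ∀ a ≥ 0, ν (j + 1) (Ioi a) ≤ ν j (Ioi a) := by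
    intro j a ha
    have := (lintegral_eulerStep_le hk hDt (step_mul_lintegral_le_one hc hΔ (hmass j))
      (h := (Ioi a).indicator 1) (measurable_one.indicator measurableSet_Ioi)
      (ψ := fun _ => 0) measurable_const
      (lintegral_fst_mul_kernel_ne_top hc hct (measurable_one.indicator measurableSet_Ioi)
        (by rw [lintegral_indicator_one measurableSet_Ioi]; exact measure_ne_top _ _))).1 (by
          intro x hx y hy
          simp only [mul_zero, add_zero, indicator, mem_Ioi, Pi.one_apply]
          by_cases hxa : a < x
          · simp only [hxa, if_true]
            exact le_trans (by split_ifs <;> simp) le_self_add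
          · by_cases hya : a < y
            · simp only [hya, if_true]
              exact le_trans (by split_ifs <;> simp) le_add_self
            · rw [if_neg]
              · simp
              · rw [not_lt, abs_le]; constructor <;> linarith)
    simpa only [lintegral_indicator_one measurableSet_Ioi, zero_mul, lintegral_zero, mul_zero,
      add_zero, hν, eulerSeq_succ] using this
  have hanti : ∀ a ≥ 0, Antitone (fun j => ν j (Ioi a)) := fun a ha =>
    antitone_nat_of_succ_le fun j => hstep j a ha
  obtain ⟨Y, hY⟩ : ∃ Y : ℝ → ℝ → ℝ≥0∞, ∀ s u, Y s u = quant (ν ⌊s / Δ⌋₊) u := ⟨_, fun _ _ => rfl⟩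
  refine ⟨Y, ?_, ?_, ?_, ?_, ?_⟩
  · have : Function.uncurry Y = fun q : ℝ × ℝ => quant (ν ⌊q.1 / Δ⌋₊) q.2 := by
      ext q; exact hY _ _
    rw [this]
    exact measurable_quant_floor ν Δ
  · intro u s t hst
    simp only [hY]
    exact quant_mono (fun a ha => hanti a ha (Nat.floor_mono (by gcongr))) u
  · intro t u v huv
    simp only [hY]
    exact quant_antitone _ huv
  · intro t u
    have h0 : ν 0 = μ := by rw [hν]; rfl
    rw [hY, ← h0]
    exact quant_mono (fun a ha => hanti a ha (Nat.zero_le _)) u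
  · intro h ψ hh hψ h0 hfin H t ht
    have hkm := hk.measurable
    have e1 : ∫⁻ u, h (Y t u).toReal ∂m = ∫⁻ x, h x ∂(ν ⌊t / Δ⌋₊) := by
      simp only [hY, hm]; exact lintegral_quant (hmass' _) hh h0
    have e2 := lintegral_quant_floor hmass' hΔ0 (g := fun p => ψ p * k p) (by fun_prop)
      (fun x y hx => by simp [hk.eq_zero x y hx]) (fun x y hy => by simp [hk.eq_zero_right x y hy])
      ht hY
    rw [← hm] at e2
    rw [e1, e2, ← hD]
    rw [hν]
    exact lintegral_eulerSeq hk hDt hct hc hΔ hh hψ hfin H ⌊t / Δ⌋₊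

lemma exists_subseq_tendsto {ι : Type*} [Countable ι] (F : ℕ → ι → ℝ≥0∞) :
    ∃ φ : ℕ → ℕ, StrictMono φ ∧ ∀ i, ∃ l, Tendsto (fun n => F (φ n) i) atTop (𝓝 l) := by
  obtain ⟨a, φ, hφ, h⟩ := CompactSpace.tendsto_subseq F
  exact ⟨φ, hφ, fun i => ⟨a i, (tendsto_pi_nhds.1 h) i⟩⟩

lemma exists_countable_forall_tendsto {g : ℕ → ℝ → ℝ≥0∞} (hg : ∀ n, Antitone (g n))
    (hq : ∀ q : ℚ, ∃ l, Tendsto (fun n => g n q) atTop (𝓝 l)) :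
    ∃ D : Set ℝ, D.Countable ∧ ∀ x ∉ D, ∃ l, Tendsto (fun n => g n x) atTop (𝓝 l) := by
  have hG : Antitone (fun x => limsup (fun n => g n x) atTop) := fun x y hxy =>
    limsup_le_limsup (Eventually.of_forall fun n => hg n hxy)
  refine ⟨_, hG.countable_not_continuousAt, fun x hx => ?_⟩
  have hx : ContinuousAt (fun x => limsup (fun n => g n x) atTop) x := by
    simpa using hx
  refine ⟨_, tendsto_of_le_liminf_of_limsup_le ?_ le_rfl⟩
  by_contra! hlt
  obtain ⟨ε, hε, hball⟩ := Metric.eventually_nhds_iff.1 (hx.eventually (lt_mem_nhds hlt))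
  obtain ⟨q, hxq, hqx⟩ := exists_rat_btwn (lt_add_of_pos_right x hε)
  have hq' := hball (y := (q : ℝ)) (by rw [Real.dist_eq, abs_lt]; constructor <;> linarith)
  obtain ⟨l, hl⟩ := hq q
  rw [hl.limsup_eq, ← hl.liminf_eq] at hq'
  exact hq'.not_ge (liminf_le_liminf (Eventually.of_forall fun n => hg n hxq.le))

/-- Helly's selection theorem for functions that decrease in both variables: along a
subsequence they converge, for every `t`, at all but countably many `u`. -/
lemma exists_subseq_tendsto_of_antitone {Y : ℕ → ℝ → ℝ → ℝ≥0∞}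
    (ht : ∀ n u, Antitone fun t => Y n t u) (hu : ∀ n t, Antitone (Y n t)) :
    ∃ φ : ℕ → ℕ, StrictMono φ ∧ ∀ t, ∃ D : Set ℝ, D.Countable ∧
      ∀ u ∉ D, ∃ l, Tendsto (fun n => Y (φ n) t u) atTop (𝓝 l) := by
  obtain ⟨φ, hφ, h1⟩ := exists_subseq_tendsto (fun n (p : ℚ × ℚ) => Y n p.1 p.2)
  choose D hD h2 using fun q : ℚ => exists_countable_forall_tendsto
    (g := fun n t => Y (φ n) t q) (fun n => ht _ _) (fun p => h1 (p, q))
  have hDc : (⋃ q, D q).Countable := countable_iUnion hD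
  have : Countable ↥(⋃ q, D q) := hDc.to_subtype
  obtain ⟨χ, hχ, h3⟩ := exists_subseq_tendsto
    (fun n (p : ↥(⋃ q, D q) × ℚ) => Y (φ n) p.1 p.2)
  refine ⟨φ ∘ χ, hφ.comp hχ, fun t => exists_countable_forall_tendsto (fun n => hu _ _) fun q => ?_⟩
  by_cases htD : t ∈ ⋃ q, D q
  · exact h3 (⟨t, htD⟩, q)
  · obtain ⟨l, hl⟩ := h2 q t fun h => htD (mem_iUnion.2 ⟨q, h⟩)
    exact ⟨l, hl.comp hχ.tendsto_atTop⟩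

lemma exists_subseq_tendsto_ae_of_antitone {Y : ℕ → ℝ → ℝ → ℝ≥0∞}
    (hm : ∀ n, Measurable (Function.uncurry (Y n)))
    (ht : ∀ n u, Antitone fun t => Y n t u) (hu : ∀ n t, Antitone (Y n t)) {b : ℝ → ℝ≥0∞}
    (hb : ∀ n t u, Y n t u ≤ b u) (hbt : ∀ u > 0, b u ≠ ∞) :
    ∃ φ : ℕ → ℕ, StrictMono φ ∧ ∃ X : ℝ → ℝ → ℝ, Measurable (Function.uncurry X) ∧
      (∀ t u, 0 ≤ X t u) ∧
      ∀ t, ∀ᵐ u, 0 < u → Tendsto (fun n => (Y (φ n) t u).toReal) atTop (𝓝 (X t u)) := by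
  obtain ⟨φ, hφ, h⟩ := exists_subseq_tendsto_of_antitone ht hu
  refine ⟨φ, hφ, fun t u => (limsup (fun n => Y (φ n) t u) atTop).toReal, ?_,
    fun t u => ENNReal.toReal_nonneg, fun t => ?_⟩
  · exact (Measurable.limsup fun n => hm (φ n)).ennreal_toReal
  · obtain ⟨D, hD, hl⟩ := h t
    filter_upwards [compl_mem_ae_iff.2 (hD.measure_zero volume)] with u huD hu0
    obtain ⟨l, hl⟩ := hl u huD
    rw [hl.limsup_eq]
    exact (ENNReal.tendsto_toReal
      (ne_top_of_le_ne_top (hbt u hu0) (le_of_tendsto' hl fun n => hb _ _ _))).comp hl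

lemma add_le_of_le_liminf {a b : ℕ → ℝ≥0∞} {A B C : ℝ≥0∞} (hA : A ≤ liminf a atTop)
    (hB : B ≤ liminf b atTop) (h : ∀ n, a n + b n ≤ C) : A + B ≤ C := by
  refine le_of_forall_lt fun c hc => ?_
  rcases eq_or_ne A 0 with rfl | hA0
  · rw [zero_add] at hc
    obtain ⟨n, hn⟩ := (eventually_lt_of_lt_liminf (hc.trans_le hB)).exists
    exact hn.trans_le (le_add_self.trans (h n))
  rcases eq_or_ne B 0 with rfl | hB0
  · rw [add_zero] at hc
    obtain ⟨n, hn⟩ := (eventually_lt_of_lt_liminf (hc.trans_le hA)).exists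
    exact hn.trans_le (le_self_add.trans (h n))
  obtain ⟨a', ha', b', hb', hab⟩ := ENNReal.exists_lt_add_of_lt_add hc hA0 hB0
  obtain ⟨n, h1, h2⟩ := ((eventually_lt_of_lt_liminf (ha'.trans_le hA)).and
    (eventually_lt_of_lt_liminf (hb'.trans_le hB))).exists
  exact hab.trans_le ((add_le_add h1.le h2.le).trans (h n))

lemma le_add_of_limsup_le {a b : ℕ → ℝ≥0∞} {A B C : ℝ≥0∞} (hA : limsup a atTop ≤ A)
    (hB : limsup b atTop ≤ B) (h : ∀ n, C ≤ a n + b n) : C ≤ A + B := by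
  refine ENNReal.le_of_forall_pos_le_add fun ε hε hAB => ?_
  have hε2 : (ε : ℝ≥0∞) / 2 ≠ 0 := by simp [hε.ne']
  obtain ⟨n, h1, h2⟩ := ((eventually_lt_of_limsup_lt
    (hA.trans_lt (ENNReal.lt_add_right (ENNReal.add_lt_top.1 hAB).1.ne hε2))).and
    (eventually_lt_of_limsup_lt
    (hB.trans_lt (ENNReal.lt_add_right (ENNReal.add_lt_top.1 hAB).2.ne hε2)))).exists
  refine (h n).trans ((add_le_add h1.le h2.le).trans_eq ?_)
  rw [add_add_add_comm, ENNReal.add_halves]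

/-- The data of a sequence of particle size families `x n` (with truncated kernels `κ n` and
time cut-offs `δ n`) that satisfy the weak coagulation equation with initial datum `μ`,
and that converge pointwise to `X`. -/
structure IsApprox (k : ℝ × ℝ → ℝ≥0∞) (μ m : Measure ℝ) (X : ℝ → ℝ → ℝ) (x : ℕ → ℝ → ℝ → ℝ)
    (κ : ℕ → ℝ × ℝ → ℝ≥0∞) (δ : ℕ → ℝ → ℝ) : Prop where
  kernel : IsCollisionKernel k
  kernel_ne_top : ∀ p, k p ≠ ∞
  kernel_cont : ContinuousOn k (Ioi 0 ×ˢ Ioi 0)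
  meas_x : ∀ n, Measurable (Function.uncurry (x n))
  meas_X : Measurable (Function.uncurry X)
  meas_κ : ∀ n, Measurable (κ n)
  X_nonneg : ∀ t u, 0 ≤ X t u
  tendsto_x : ∀ t, ∀ᵐ u ∂m, Tendsto (fun n => x n t u) atTop (𝓝 (X t u))
  κ_le : ∀ n p, κ n p ≤ k p
  tendsto_κ : ∀ p : ℝ × ℝ, 0 < p.1 → 0 < p.2 → ∀ y : ℕ → ℝ × ℝ, Tendsto y atTop (𝓝 p) →
    Tendsto (fun n => κ n (y n)) atTop (𝓝 (k p))
  tendsto_δ : ∀ s t, s < t → 0 ≤ t → ∀ᶠ n in atTop, s < δ n t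
  estimate : ∀ (n : ℕ) (h : ℝ → ℝ≥0∞) (ψ : ℝ × ℝ → ℝ≥0∞), Measurable h → Measurable ψ →
    (∀ x ≤ 0, h x = 0) → ∫⁻ x, h x ∂μ ≠ ∞ →
    (∀ x > 0, ∀ y > 0, h |x - y| + 2 * ψ (x, y) ≤ h x + h y) → ∀ t ≥ 0,
    (∫⁻ u, h (x n t u) ∂m + ∫⁻ ω, (Iio (δ n t)).indicator
        (fun s => ψ (x n s ω.2.1, x n s ω.2.2) * κ n (x n s ω.2.1, x n s ω.2.2)) ω.1
        ∂((volume.restrict (Ico 0 t)).prod (m.prod m)) ≤ ∫⁻ x, h x ∂μ) ∧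
    ((∀ x > 0, ∀ y > 0, h |x - y| + 2 * ψ (x, y) = h x + h y) →
      ∫⁻ u, h (x n t u) ∂m + ∫⁻ ω, (Iio (δ n t)).indicator
        (fun s => ψ (x n s ω.2.1, x n s ω.2.2) * κ n (x n s ω.2.1, x n s ω.2.2)) ω.1
        ∂((volume.restrict (Ico 0 t)).prod (m.prod m)) = ∫⁻ x, h x ∂μ)

section Limit

variable {k : ℝ × ℝ → ℝ≥0∞} {μ m : Measure ℝ} {X : ℝ → ℝ → ℝ} {x : ℕ → ℝ → ℝ → ℝ}
  {κ : ℕ → ℝ × ℝ → ℝ≥0∞} {δ : ℕ → ℝ → ℝ}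

lemma measurable_pair {Z : ℝ → ℝ → ℝ} (hZ : Measurable (Function.uncurry Z)) :
    Measurable (fun ω : ℝ × ℝ × ℝ => (Z ω.1 ω.2.1, Z ω.1 ω.2.2)) := by
  have h1 : Measurable (fun ω : ℝ × ℝ × ℝ => Z ω.1 ω.2.1) :=
    hZ.comp (measurable_fst.prodMk measurable_snd.fst)
  have h2 : Measurable (fun ω : ℝ × ℝ × ℝ => Z ω.1 ω.2.2) :=
    hZ.comp (measurable_fst.prodMk measurable_snd.snd)
  exact h1.prodMk h2

namespace IsApprox

lemma ae_tendsto_pair [SFinite m] (H : IsApprox k μ m X x κ δ) (t : ℝ) (ht : 0 ≤ t) :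
    ∀ᵐ ω ∂((volume.restrict (Ico 0 t)).prod (m.prod m)),
      Tendsto (fun n => (x n ω.1 ω.2.1, x n ω.1 ω.2.2)) atTop (𝓝 (X ω.1 ω.2.1, X ω.1 ω.2.2)) ∧
      ∀ᶠ n in atTop, ω.1 < δ n t := by
  have hS : MeasurableSet {ω : ℝ × ℝ × ℝ |
      Tendsto (fun n => (x n ω.1 ω.2.1, x n ω.1 ω.2.2)) atTop (𝓝 (X ω.1 ω.2.1, X ω.1 ω.2.2))} :=
    measurableSet_tendsto_fun (fun n => measurable_pair (H.meas_x n)) (measurable_pair H.meas_X)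
  have h1 := (Measure.ae_prod_iff_ae_ae (μ := volume.restrict (Ico 0 t)) (ν := m.prod m) hS).2
    (Eventually.of_forall fun s => by
      filter_upwards [Measure.quasiMeasurePreserving_fst.ae (H.tendsto_x s),
        Measure.quasiMeasurePreserving_snd.ae (H.tendsto_x s)] with p h1 h2
      exact h1.prodMk_nhds h2)
  have h2 : ∀ᵐ ω ∂((volume.restrict (Ico 0 t)).prod (m.prod m)), ω.1 ∈ Ico 0 t :=
    Measure.quasiMeasurePreserving_fst.ae (ae_restrict_mem measurableSet_Ico)
  filter_upwards [h1, h2] with ω h1 h2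
  exact ⟨h1, H.tendsto_δ _ _ h2.2 ht⟩

/-- Lower semicontinuity of the weak formulation along the approximation. -/
lemma lintegral_add_le [SFinite m] (H : IsApprox k μ m X x κ δ) {h : ℝ → ℝ≥0∞} {ψ : ℝ × ℝ → ℝ≥0∞}
    (hh : Measurable h) (hψ : Measurable ψ) (h0 : ∀ x ≤ 0, h x = 0) (hfin : ∫⁻ x, h x ∂μ ≠ ∞)
    (hle : ∀ x > 0, ∀ y > 0, h |x - y| + 2 * ψ (x, y) ≤ h x + h y)
    (hhc : ContinuousOn h (Ioi 0)) (hψc : ContinuousOn ψ (Ioi 0 ×ˢ Ioi 0))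
    (hψt : ∀ p, ψ p ≠ ∞) {t : ℝ} (ht : 0 ≤ t) :
    ∫⁻ u, h (X t u) ∂m + ∫⁻ ω, ψ (X ω.1 ω.2.1, X ω.1 ω.2.2) * k (X ω.1 ω.2.1, X ω.1 ω.2.2)
      ∂((volume.restrict (Ico 0 t)).prod (m.prod m)) ≤ ∫⁻ x, h x ∂μ := by
  refine add_le_of_le_liminf ?_ ?_ fun n => (H.estimate n h ψ hh hψ h0 hfin hle t ht).1
  · refine le_trans (lintegral_mono_ae ?_) (lintegral_liminf_le fun n =>
      hh.comp ((H.meas_x n).comp measurable_prodMk_left))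
    filter_upwards [H.tendsto_x t] with u hu
    rcases (H.X_nonneg t u).eq_or_lt with h1 | h1
    · rw [← h1, h0 0 le_rfl]; exact zero_le
    · exact (((hhc.continuousAt (Ioi_mem_nhds h1)).tendsto.comp hu).liminf_eq).ge
  · refine le_trans (lintegral_mono_ae ?_) (lintegral_liminf_le fun n => ?_)
    · filter_upwards [H.ae_tendsto_pair t ht] with ω hω
      rcases (H.X_nonneg ω.1 ω.2.1).eq_or_lt with h1 | h1
      · rw [H.kernel.eq_zero _ _ h1.ge, mul_zero]; exact zero_le
      rcases (H.X_nonneg ω.1 ω.2.2).eq_or_lt with h2 | h2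
      · rw [H.kernel.eq_zero_right _ _ h2.ge, mul_zero]; exact zero_le
      have hmem : Ioi (0 : ℝ) ×ˢ Ioi (0 : ℝ) ∈ 𝓝 (X ω.1 ω.2.1, X ω.1 ω.2.2) :=
        prod_mem_nhds (Ioi_mem_nhds h1) (Ioi_mem_nhds h2)
      have hlim := ENNReal.Tendsto.mul ((hψc.continuousAt hmem).tendsto.comp hω.1)
        (Or.inr (H.kernel_ne_top _)) (H.tendsto_κ (X ω.1 ω.2.1, X ω.1 ω.2.2) h1 h2 _ hω.1)
        (Or.inr (hψt _))
      rw [← hlim.liminf_eq]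
      refine (liminf_congr ?_).le
      filter_upwards [hω.2] with n hn
      rw [indicator_of_mem (mem_Iio.2 hn)]
      rfl
    · exact ((hψ.comp (measurable_pair (H.meas_x n))).mul
        ((H.meas_κ n).comp (measurable_pair (H.meas_x n)))).indicator
        (measurable_fst (measurableSet_Iio (a := δ n t)))

end IsApprox
end Limit

/-- The loss of `h`-moment in the collision of two particles. -/
noncomputable def collisionLoss (h : ℝ → ℝ) (p : ℝ × ℝ) : ℝ := (h p.1 + h p.2 - h |p.1 - p.2|) / 2

section CollisionLoss

variable {h : ℝ → ℝ} {C : ℝ≥0}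

lemma collisionLoss_comm (h : ℝ → ℝ) (x y : ℝ) :
    collisionLoss h (x, y) = collisionLoss h (y, x) := by
  simp only [collisionLoss, abs_sub_comm x y, add_comm (h x)]

lemma collisionLoss_nonneg (hmono : Monotone h) (h0 : ∀ x ≤ 0, h x = 0) {x y : ℝ} (hx : 0 < x)
    (hy : 0 < y) : 0 ≤ collisionLoss h (x, y) := by
  have hnn : ∀ z, 0 ≤ h z := fun z => by
    rcases le_total z 0 with hz | hz
    · exact (h0 z hz).ge
    · exact (h0 0 le_rfl).symm.le.trans (hmono hz)
  have : h |x - y| ≤ h x + h y := by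
    rcases le_total y x with hyx | hyx
    · rw [abs_of_nonneg (sub_nonneg.2 hyx)]
      linarith [hmono (show x - y ≤ x by linarith), hnn y]
    · rw [abs_of_nonpos (sub_nonpos.2 hyx)]
      linarith [hmono (show -(x - y) ≤ y by linarith), hnn x]
  simp only [collisionLoss]
  linarith

lemma collisionLoss_le_one (hmono : Monotone h) (h0 : ∀ x ≤ 0, h x = 0) (h1 : ∀ x, h x ≤ 1)
    (p : ℝ × ℝ) : collisionLoss h p ≤ 1 := by
  have : 0 ≤ h |p.1 - p.2| := (h0 0 le_rfl).symm.le.trans (hmono (abs_nonneg _))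
  simp only [collisionLoss]
  linarith [h1 p.1, h1 p.2]

lemma collisionLoss_le_mul_min (hL : LipschitzWith C h) (h0 : ∀ x ≤ 0, h x = 0) {x y : ℝ}
    (hx : 0 < x) (hy : 0 < y) : collisionLoss h (x, y) ≤ C * min x y := by
  wlog hyx : y ≤ x generalizing x y
  · rw [collisionLoss_comm, min_comm]
    exact this hy hx (le_of_not_ge hyx)
  rw [min_eq_right hyx]
  have e1 := hL.dist_le_mul x (x - y)
  have e2 := hL.dist_le_mul y 0
  rw [Real.dist_eq, Real.dist_eq, sub_sub_cancel, abs_of_pos hy] at e1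
  rw [Real.dist_eq, Real.dist_eq, sub_zero, h0 0 le_rfl, sub_zero, abs_of_pos hy] at e2
  simp only [collisionLoss, abs_of_nonneg (sub_nonneg.2 hyx)]
  linarith [le_abs_self (h x - h (x - y)), le_abs_self (h y)]

lemma ofReal_add_two_mul_collisionLoss (hmono : Monotone h) (h0 : ∀ x ≤ 0, h x = 0) {x y : ℝ}
    (hx : 0 < x) (hy : 0 < y) :
    ENNReal.ofReal (h |x - y|) + 2 * ENNReal.ofReal (collisionLoss h (x, y))
      = ENNReal.ofReal (h x) + ENNReal.ofReal (h y) := by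
  have hnn : ∀ z, 0 ≤ h z := fun z => by
    rcases le_total z 0 with hz | hz
    · exact (h0 z hz).ge
    · exact (h0 0 le_rfl).symm.le.trans (hmono hz)
  have hc := collisionLoss_nonneg hmono h0 hx hy
  rw [show (2 : ℝ≥0∞) = ENNReal.ofReal 2 by simp, ← ENNReal.ofReal_mul (by norm_num),
    ← ENNReal.ofReal_add (hnn _) (by positivity), ← ENNReal.ofReal_add (hnn _) (hnn _)]
  congr 1
  simp only [collisionLoss]
  ring

lemma continuous_collisionLoss (hc : Continuous h) : Continuous (collisionLoss h) := by
  unfold collisionLoss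
  fun_prop

/-- The part of the first moment above `R` that is lost in a collision. -/
noncomputable def tailLoss (R : ℝ) (p : ℝ × ℝ) : ℝ :=
  min (min p.1 p.2) (max (max p.1 p.2 - R) 0) / 2

lemma continuous_tailLoss (R : ℝ) : Continuous (tailLoss R) := by
  unfold tailLoss
  fun_prop

lemma tailLoss_nonneg {R x y : ℝ} (hx : 0 < x) (hy : 0 < y) : 0 ≤ tailLoss R (x, y) := by
  unfold tailLoss
  positivity

lemma ofReal_add_two_mul_tailLoss_le {R x y : ℝ} (hx : 0 < x) (hy : 0 < y) :
    ENNReal.ofReal (|x - y| - R) + 2 * ENNReal.ofReal (tailLoss R (x, y))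
      ≤ ENNReal.ofReal (x - R) + ENNReal.ofReal (y - R) := by
  have key : max (|x - y| - R) 0 + 2 * tailLoss R (x, y) ≤ max (x - R) 0 + max (y - R) 0 := by
    simp only [tailLoss]
    wlog hyx : y ≤ x generalizing x y
    · have := this hy hx (le_of_not_ge hyx)
      rwa [abs_sub_comm, min_comm y x, max_comm y x, add_comm (max (y - R) 0)] at this
    rw [min_eq_right hyx, max_eq_left hyx, abs_of_nonneg (sub_nonneg.2 hyx)]
    have h3 := le_max_right (y - R) 0
    rcases le_total (x - R) 0 with h1 | h1
    · rw [max_eq_right h1, max_eq_right (by linarith : x - y - R ≤ 0), min_eq_right hy.le]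
      linarith
    · rw [max_eq_left h1]
      rcases le_total (x - y - R) 0 with h2 | h2
      · rw [max_eq_right h2]
        linarith [min_le_right y (x - R)]
      · rw [max_eq_left h2]
        linarith [min_le_left y (x - R)]
  have e : ∀ z, ENNReal.ofReal z = ENNReal.ofReal (max z 0) := fun z => by
    rcases le_total z 0 with hz | hz
    · rw [max_eq_right hz, ENNReal.ofReal_of_nonpos hz, ENNReal.ofReal_zero]
    · rw [max_eq_left hz]
  have ht := tailLoss_nonneg (R := R) hx hy
  rw [e (|x - y| - R), e (x - R), e (y - R), show (2 : ℝ≥0∞) = ENNReal.ofReal 2 by simp,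
    ← ENNReal.ofReal_mul (by norm_num), ← ENNReal.ofReal_add (by positivity) (by positivity),
    ← ENNReal.ofReal_add (by positivity) (by positivity)]
  exact ENNReal.ofReal_le_ofReal key

lemma ofReal_collisionLoss_le (hmono : Monotone h) (h0 : ∀ x ≤ 0, h x = 0) (h1 : ∀ x, h x ≤ 1)
    (hL : LipschitzWith C h) (hC : 1 ≤ C) {ε R x y : ℝ} (hx : 0 < x) (hy : 0 < y) :
    ENNReal.ofReal (collisionLoss h (x, y)) ≤
      (Icc ε (R + 1) ×ˢ Icc ε (R + 1)).indicator (fun p => ENNReal.ofReal (collisionLoss h p))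
          (x, y) + (ENNReal.ofReal (C * ε) + 2 * C * ENNReal.ofReal (tailLoss R (x, y))) := by
  have hm := collisionLoss_le_mul_min hL h0 hx hy
  by_cases hG : (x, y) ∈ Icc ε (R + 1) ×ˢ Icc ε (R + 1)
  · rw [indicator_of_mem hG]
    exact le_self_add
  rw [indicator_of_notMem hG, zero_add]
  have hC' : (1 : ℝ) ≤ C := by exact_mod_cast hC
  rcases lt_or_ge (min x y) ε with h2 | h2
  · refine le_trans (ENNReal.ofReal_le_ofReal ?_) le_self_add
    exact hm.trans (by gcongr)
  · refine le_trans ?_ le_add_self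
    have h3 : R + 1 ≤ max x y := by
      by_contra! h4
      refine hG ?_
      simp only [mem_prod, mem_Icc]
      rw [le_min_iff] at h2
      rw [max_lt_iff] at h4
      exact ⟨⟨h2.1, h4.1.le⟩, h2.2, h4.2.le⟩
    have h5 : collisionLoss h (x, y) ≤ 2 * C * tailLoss R (x, y) := by
      simp only [tailLoss]
      rw [max_eq_left (by linarith : 0 ≤ max x y - R)]
      have := (collisionLoss_le_one hmono h0 h1 (x, y))
      have : collisionLoss h (x, y) ≤ C * min (min x y) (max x y - R) := by
        rw [mul_min_of_nonneg _ _ (by positivity : (0 : ℝ) ≤ C)]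
        refine le_min hm ?_
        nlinarith
      linarith
    calc ENNReal.ofReal (collisionLoss h (x, y)) ≤ ENNReal.ofReal (2 * C * tailLoss R (x, y)) :=
          ENNReal.ofReal_le_ofReal h5
      _ = _ := by
        rw [ENNReal.ofReal_mul (by positivity), ENNReal.ofReal_mul (by positivity)]
        simp

end CollisionLoss

namespace IsApprox

variable {k : ℝ × ℝ → ℝ≥0∞} {μ m : Measure ℝ} {X : ℝ → ℝ → ℝ} {x : ℕ → ℝ → ℝ → ℝ}
  {κ : ℕ → ℝ × ℝ → ℝ≥0∞} {δ : ℕ → ℝ → ℝ}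

/-- The collision integral of `ψ` along the approximation. -/
noncomputable def gain (m : Measure ℝ) (x : ℕ → ℝ → ℝ → ℝ) (κ : ℕ → ℝ × ℝ → ℝ≥0∞)
    (δ : ℕ → ℝ → ℝ) (t : ℝ) (n : ℕ) (ψ : ℝ × ℝ → ℝ≥0∞) : ℝ≥0∞ :=
  ∫⁻ ω, (Iio (δ n t)).indicator
    (fun s => ψ (x n s ω.2.1, x n s ω.2.2) * κ n (x n s ω.2.1, x n s ω.2.2)) ω.1
    ∂((volume.restrict (Ico 0 t)).prod (m.prod m))

lemma measurable_integrand (H : IsApprox k μ m X x κ δ) (n : ℕ) (t : ℝ) {ψ : ℝ × ℝ → ℝ≥0∞}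
    (hψ : Measurable ψ) : Measurable (fun ω : ℝ × ℝ × ℝ => (Iio (δ n t)).indicator
      (fun s => ψ (x n s ω.2.1, x n s ω.2.2) * κ n (x n s ω.2.1, x n s ω.2.2)) ω.1) :=
  ((hψ.comp (measurable_pair (H.meas_x n))).mul
    ((H.meas_κ n).comp (measurable_pair (H.meas_x n)))).indicator
    (measurable_fst (measurableSet_Iio (a := δ n t)))

lemma κ_eq_zero (H : IsApprox k μ m X x κ δ) (n : ℕ) {a b : ℝ} (h : a ≤ 0 ∨ b ≤ 0) :
    κ n (a, b) = 0 := by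
  refine le_antisymm ((H.κ_le n _).trans_eq ?_) zero_le
  exact h.elim (H.kernel.eq_zero _ _) (H.kernel.eq_zero_right _ _)

lemma gain_le (H : IsApprox k μ m X x κ δ) (n : ℕ) (t : ℝ) {ψ χ₁ χ₂ χ₃ : ℝ × ℝ → ℝ≥0∞}
    (c : ℝ≥0∞) (h₁ : Measurable χ₁) (h₂ : Measurable χ₂) (h₃ : Measurable χ₃)
    (hle : ∀ a > 0, ∀ b > 0, ψ (a, b) ≤ χ₁ (a, b) + (χ₂ (a, b) + c * χ₃ (a, b))) :
    gain m x κ δ t n ψ ≤ gain m x κ δ t n χ₁ + (gain m x κ δ t n χ₂ + c * gain m x κ δ t n χ₃) := by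
  unfold gain
  rw [← lintegral_const_mul _ (H.measurable_integrand n t h₃),
    ← lintegral_add_left (H.measurable_integrand n t h₂),
    ← lintegral_add_left (H.measurable_integrand n t h₁)]
  refine lintegral_mono fun ω => ?_
  by_cases hω : ω.1 ∈ Iio (δ n t)
  · simp only [indicator_of_mem hω]
    by_cases h : x n ω.1 ω.2.1 ≤ 0 ∨ x n ω.1 ω.2.2 ≤ 0
    · rw [H.κ_eq_zero n h]; simp
    · rw [not_or, not_le, not_le] at h
      rw [← mul_assoc, ← add_mul, ← add_mul]
      exact mul_le_mul_left (hle _ h.1 _ h.2) _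
  · simp only [indicator_of_notMem hω, zero_le]

lemma gain_const_le [IsFiniteMeasure μ] (H : IsApprox k μ m X x κ δ) (n : ℕ) {t : ℝ} (ht : 0 ≤ t)
    (c : ℝ≥0∞) : gain m x κ δ t n (fun _ => c) ≤ c * (2 * μ univ) := by
  have h := (H.estimate n ((Ioi 0).indicator 1) (fun _ => 2⁻¹)
    (measurable_one.indicator measurableSet_Ioi) measurable_const (fun x hx => by simp [hx])
    (by rw [lintegral_indicator_one measurableSet_Ioi]; exact measure_ne_top _ _)
    (fun a ha b hb => by
      rw [ENNReal.mul_inv_cancel (by simp) (by simp), indicator_of_mem (mem_Ioi.2 ha),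
        indicator_of_mem (mem_Ioi.2 hb)]
      exact add_le_add (indicator_le_self' (fun _ _ => zero_le) _) le_rfl) t ht).1
  have h' : gain m x κ δ t n (fun _ => 2⁻¹) ≤ μ univ := le_add_self.trans (h.trans (by
    rw [lintegral_indicator_one measurableSet_Ioi]; exact measure_mono (subset_univ _)))
  have h2 : gain m x κ δ t n (fun _ => c) ≤ gain m x κ δ t n 0 + (gain m x κ δ t n 0
      + (c * 2) * gain m x κ δ t n (fun _ => 2⁻¹)) :=
    H.gain_le n t (c * 2) measurable_zero measurable_zero measurable_const fun a _ b _ => by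
      simp [mul_assoc, ENNReal.mul_inv_cancel]
  have h3 : gain m x κ δ t n 0 = 0 := by simp [gain]
  rw [h3, zero_add, zero_add] at h2
  calc _ ≤ _ := h2
    _ ≤ c * 2 * μ univ := by gcongr
    _ = _ := mul_assoc _ _ _

lemma gain_tailLoss_le (H : IsApprox k μ m X x κ δ) (n : ℕ) {t : ℝ} (ht : 0 ≤ t)
    (hmom : ∫⁻ x, ENNReal.ofReal x ∂μ ≠ ∞) {R : ℝ} (hR : 0 ≤ R) :
    gain m x κ δ t n (fun p => ENNReal.ofReal (tailLoss R p))
      ≤ ∫⁻ x, ENNReal.ofReal (x - R) ∂μ := by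
  refine le_add_self.trans (H.estimate n (fun x => ENNReal.ofReal (x - R))
    (fun p => ENNReal.ofReal (tailLoss R p)) (by fun_prop)
    (continuous_tailLoss R).measurable.ennreal_ofReal
    (fun x hx => ENNReal.ofReal_of_nonpos (by linarith)) ?_
    (fun a ha b hb => ofReal_add_two_mul_tailLoss_le ha hb) t ht).1
  refine ne_top_of_le_ne_top hmom (lintegral_mono fun x => ENNReal.ofReal_le_ofReal ?_)
  linarith

lemma limsup_gain_le [IsFiniteMeasure m] (H : IsApprox k μ m X x κ δ) {ψ : ℝ × ℝ → ℝ≥0∞}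
    (hψ : Continuous ψ) (hψ1 : ∀ p, ψ p ≤ 1) {t : ℝ} (ht : 0 ≤ t) {ε R : ℝ} (hε : 0 < ε) :
    limsup (fun n => gain m x κ δ t n ((Icc ε R ×ˢ Icc ε R).indicator ψ)) atTop
      ≤ ∫⁻ ω, ψ (X ω.1 ω.2.1, X ω.1 ω.2.2) * k (X ω.1 ω.2.1, X ω.1 ω.2.2)
        ∂((volume.restrict (Ico 0 t)).prod (m.prod m)) := by
  have hGm : MeasurableSet (Icc ε R ×ˢ Icc ε R) := measurableSet_Icc.prod measurableSet_Icc
  obtain ⟨B, hBt, hB⟩ : ∃ B : ℝ≥0∞, B ≠ ∞ ∧ ∀ p ∈ Icc ε R ×ˢ Icc ε R, k p ≤ B := by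
    rcases (Icc ε R ×ˢ Icc ε R).eq_empty_or_nonempty with he | hne
    · exact ⟨0, by simp, by simp [he]⟩
    · obtain ⟨p, _, hp⟩ := (isCompact_Icc.prod isCompact_Icc).exists_isMaxOn hne
        (H.kernel_cont.mono (prod_mono (fun z hz => hε.trans_le hz.1) fun z hz => hε.trans_le hz.1))
      exact ⟨k p, H.kernel_ne_top p, fun q hq => hp hq⟩
  refine (limsup_lintegral_le (fun _ => B)
    (fun n => H.measurable_integrand n t (hψ.measurable.indicator hGm)) (fun n => ?_) ?_).trans
      (lintegral_mono_ae ?_)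
  · refine Eventually.of_forall fun ω => ?_
    by_cases hω : ω.1 ∈ Iio (δ n t)
    · simp only [indicator_of_mem hω]
      by_cases h : (x n ω.1 ω.2.1, x n ω.1 ω.2.2) ∈ Icc ε R ×ˢ Icc ε R
      · rw [indicator_of_mem h]
        calc _ ≤ 1 * B := mul_le_mul' (hψ1 _) ((H.κ_le n _).trans (hB _ h))
          _ = B := one_mul B
      · rw [indicator_of_notMem h, zero_mul]; exact zero_le
    · simp only [indicator_of_notMem hω, zero_le]
  · rw [lintegral_const]
    exact ENNReal.mul_ne_top hBt (measure_ne_top _ _)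
  · filter_upwards [H.ae_tendsto_pair t ht] with ω hω
    by_cases hpos : 0 < X ω.1 ω.2.1 ∧ 0 < X ω.1 ω.2.2
    · have hlim := ENNReal.Tendsto.mul ((hψ.tendsto _).comp hω.1)
        (Or.inr (H.kernel_ne_top _)) (H.tendsto_κ (X ω.1 ω.2.1, X ω.1 ω.2.2) hpos.1 hpos.2 _ hω.1)
        (Or.inr (ne_top_of_le_ne_top ENNReal.one_ne_top (hψ1 _)))
      rw [← hlim.limsup_eq]
      refine limsup_le_limsup (Eventually.of_forall fun n => ?_)
      refine (indicator_le_self' (fun _ _ => zero_le) _).trans ?_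
      exact mul_le_mul_left (indicator_le_self' (fun _ _ => zero_le) _) _
    · have hev : ∀ᶠ n in atTop, (x n ω.1 ω.2.1, x n ω.1 ω.2.2) ∉ Icc ε R ×ˢ Icc ε R := by
        rw [not_and_or, not_lt, not_lt] at hpos
        rcases hpos with h | h
        · filter_upwards [(continuous_fst.tendsto _).comp hω.1 |>.eventually
            (gt_mem_nhds (h.trans_lt hε))] with n hn hmem
          exact (not_lt.2 hmem.1.1) hn
        · filter_upwards [(continuous_snd.tendsto _).comp hω.1 |>.eventually
            (gt_mem_nhds (h.trans_lt hε))] with n hn hmem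
          exact (not_lt.2 hmem.2.1) hn
      have : limsup (fun n => (Iio (δ n t)).indicator
          (fun s => (Icc ε R ×ˢ Icc ε R).indicator ψ (x n s ω.2.1, x n s ω.2.2) *
            κ n (x n s ω.2.1, x n s ω.2.2)) ω.1) atTop
          = limsup (fun _ : ℕ => (0 : ℝ≥0∞)) atTop := by
        refine limsup_congr ?_
        filter_upwards [hev] with n hn
        refine le_antisymm ((indicator_le_self' (fun _ _ => zero_le) _).trans ?_) zero_le
        rw [indicator_of_notMem hn, zero_mul]
      rw [this, limsup_const]
      exact zero_le

/-- The limit satisfies the weak formulation for bounded monotone Lipschitz test functions. -/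
lemma lintegral_add_eq [IsFiniteMeasure m] [IsFiniteMeasure μ] (H : IsApprox k μ m X x κ δ)
    (hmom : ∫⁻ x, ENNReal.ofReal x ∂μ ≠ ∞) {h : ℝ → ℝ} {C : ℝ≥0} (hmono : Monotone h)
    (h0 : ∀ x ≤ 0, h x = 0) (h1 : ∀ x, h x ≤ 1) (hL : LipschitzWith C h) (hC : 1 ≤ C) {t : ℝ}
    (ht : 0 ≤ t) :
    ∫⁻ u, ENNReal.ofReal (h (X t u)) ∂m
      + ∫⁻ ω, ENNReal.ofReal (collisionLoss h (X ω.1 ω.2.1, X ω.1 ω.2.2))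
          * k (X ω.1 ω.2.1, X ω.1 ω.2.2) ∂((volume.restrict (Ico 0 t)).prod (m.prod m))
      = ∫⁻ x, ENNReal.ofReal (h x) ∂μ := by
  have hhm : Measurable (fun x => ENNReal.ofReal (h x)) := hL.continuous.measurable.ennreal_ofReal
  have hψc : Continuous (fun p => ENNReal.ofReal (collisionLoss h p)) :=
    ENNReal.continuous_ofReal.comp (continuous_collisionLoss hL.continuous)
  have hψ1 : ∀ p, ENNReal.ofReal (collisionLoss h p) ≤ 1 := fun p =>
    ENNReal.ofReal_le_one.2 (collisionLoss_le_one hmono h0 h1 p)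
  have h0' : ∀ x ≤ 0, ENNReal.ofReal (h x) = 0 := fun x hx => by rw [h0 x hx, ENNReal.ofReal_zero]
  have hfin : ∫⁻ x, ENNReal.ofReal (h x) ∂μ ≠ ∞ := by
    refine ne_top_of_le_ne_top (measure_ne_top μ univ) ?_
    rw [← lintegral_one]
    exact lintegral_mono fun x => ENNReal.ofReal_le_one.2 (h1 x)
  have heq : ∀ x > 0, ∀ y > 0, ENNReal.ofReal (h |x - y|)
      + 2 * ENNReal.ofReal (collisionLoss h (x, y)) = ENNReal.ofReal (h x) + ENNReal.ofReal (h y) :=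
    fun x hx y hy => ofReal_add_two_mul_collisionLoss hmono h0 hx hy
  refine le_antisymm (H.lintegral_add_le hhm hψc.measurable h0' hfin
    (fun x hx y hy => (heq x hx y hy).le)
    (ENNReal.continuous_ofReal.comp hL.continuous).continuousOn hψc.continuousOn
    (fun p => ENNReal.ofReal_ne_top) ht) ?_
  have hA : Tendsto (fun n => ∫⁻ u, ENNReal.ofReal (h (x n t u)) ∂m) atTop
      (𝓝 (∫⁻ u, ENNReal.ofReal (h (X t u)) ∂m)) := by
    refine tendsto_lintegral_of_dominated_convergence (fun _ => 1)
      (fun n => hhm.comp ((H.meas_x n).comp measurable_prodMk_left))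
      (fun n => Eventually.of_forall fun u => ENNReal.ofReal_le_one.2 (h1 _)) (by simp) ?_
    filter_upwards [H.tendsto_x t] with u hu
    exact ((ENNReal.continuous_ofReal.comp hL.continuous).tendsto _).comp hu
  have htail : Tendsto (fun l : ℕ => ∫⁻ x, ENNReal.ofReal (x - l) ∂μ) atTop (𝓝 0) := by
    rw [← lintegral_zero (μ := μ)]
    refine tendsto_lintegral_of_dominated_convergence (fun x => ENNReal.ofReal x)
      (fun n => by fun_prop) (fun n => Eventually.of_forall fun u => ENNReal.ofReal_le_ofReal ?_)
      hmom (Eventually.of_forall fun x => ?_)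
    · linarith [(Nat.cast_nonneg n : (0 : ℝ) ≤ n)]
    · refine tendsto_const_nhds.congr' ?_
      filter_upwards [tendsto_natCast_atTop_atTop.eventually_ge_atTop x] with l hl
      rw [ENNReal.ofReal_of_nonpos (by linarith)]
  have herr : Tendsto (fun l : ℕ => ENNReal.ofReal (C * (1 / ((l : ℝ) + 1))) * (2 * μ univ)
      + 2 * C * ∫⁻ x, ENNReal.ofReal (x - l) ∂μ) atTop (𝓝 0) := by
    have e1 : Tendsto (fun l : ℕ => ENNReal.ofReal (C * (1 / ((l : ℝ) + 1)))) atTop (𝓝 0) := by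
      rw [← ENNReal.ofReal_zero]
      refine ENNReal.tendsto_ofReal ?_
      simpa using tendsto_one_div_add_atTop_nhds_zero_nat.const_mul (C : ℝ)
    have e2 := ENNReal.Tendsto.mul_const e1 (Or.inr
      (ENNReal.mul_ne_top (a := 2) (by simp) (measure_ne_top μ univ)))
    have e3 := ENNReal.Tendsto.const_mul (a := 2 * (C : ℝ≥0∞)) htail
      (Or.inr (ENNReal.mul_ne_top (by simp) ENNReal.coe_ne_top))
    simpa using e2.add e3
  refine ge_of_tendsto' (f := fun l : ℕ => ∫⁻ u, ENNReal.ofReal (h (X t u)) ∂m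
    + (ENNReal.ofReal (C * (1 / ((l : ℝ) + 1))) * (2 * μ univ)
      + 2 * C * ∫⁻ x, ENNReal.ofReal (x - l) ∂μ)
    + ∫⁻ ω, ENNReal.ofReal (collisionLoss h (X ω.1 ω.2.1, X ω.1 ω.2.2))
          * k (X ω.1 ω.2.1, X ω.1 ω.2.2) ∂((volume.restrict (Ico 0 t)).prod (m.prod m)))
    (x := atTop) ?_ fun l => ?_
  · simpa using (tendsto_const_nhds.add herr).add tendsto_const_nhds
  refine le_add_of_limsup_le (hA.add tendsto_const_nhds).limsup_eq.le
    (H.limsup_gain_le hψc hψ1 ht (R := (l : ℝ) + 1) (Nat.one_div_pos_of_nat (n := l))) fun n => ?_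
  rw [← (H.estimate n _ _ hhm hψc.measurable h0' hfin
    (fun x hx y hy => (heq x hx y hy).le) t ht).2 heq, add_assoc]
  refine add_le_add le_rfl ?_
  have hl : (0 : ℝ) ≤ l := Nat.cast_nonneg l
  have h2 := H.gain_le n t (ψ := fun p => ENNReal.ofReal (collisionLoss h p))
    (χ₁ := (Icc (1 / ((l : ℝ) + 1)) ((l : ℝ) + 1) ×ˢ
      Icc (1 / ((l : ℝ) + 1)) ((l : ℝ) + 1)).indicator
      (fun p => ENNReal.ofReal (collisionLoss h p)))
    (χ₂ := fun _ => ENNReal.ofReal (C * (1 / ((l : ℝ) + 1))))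
    (χ₃ := fun p => ENNReal.ofReal (tailLoss l p)) (2 * C)
    (hψc.measurable.indicator (measurableSet_Icc.prod measurableSet_Icc)) measurable_const
    (continuous_tailLoss l).measurable.ennreal_ofReal
    (fun a ha b hb => ofReal_collisionLoss_le hmono h0 h1 hL hC ha hb)
  rw [add_comm]
  refine h2.trans ?_
  gcongr
  · exact H.gain_const_le n ht _
  · exact H.gain_tailLoss_le n ht hmom hl

end IsApprox

lemma IsCollisionKernel.truncate {k : ℝ × ℝ → ℝ≥0∞} (hk : IsCollisionKernel k) (c : ℝ≥0∞) :
    IsCollisionKernel (fun p => min (k p) c) where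
  measurable := hk.measurable.min measurable_const
  symm x y := by rw [hk.symm]
  eq_zero x y hx := by rw [hk.eq_zero x y hx, min_eq_left zero_le]

lemma exists_isApprox {k : ℝ × ℝ → ℝ≥0∞} (hk : IsCollisionKernel k) (hkt : ∀ p, k p ≠ ∞)
    (hkc : ContinuousOn k (Ioi 0 ×ˢ Ioi 0)) (μ : Measure ℝ) [IsFiniteMeasure μ] :
    ∃ X x κ δ, IsApprox k μ (volume.restrict (Ioc 0 (μ univ).toReal)) X x κ δ := by
  obtain ⟨N, hN⟩ : ∃ N, N = (μ univ).toReal := ⟨_, rfl⟩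
  have hN0 : 0 ≤ N := hN ▸ ENNReal.toReal_nonneg
  have hμN : μ univ = ENNReal.ofReal N := by rw [hN, ENNReal.ofReal_toReal (measure_ne_top _ _)]
  obtain ⟨Δ, hΔ⟩ : ∃ Δ : ℕ → ℝ, ∀ n, Δ n = 1 / ((n : ℝ) + 1) / (N + 1) := ⟨_, fun _ => rfl⟩
  have hΔ0 : ∀ n, 0 < Δ n := fun n => by rw [hΔ]; positivity
  have hΔlim : Tendsto Δ atTop (𝓝 0) := by
    simp_rw [funext hΔ]
    simpa using tendsto_one_div_add_atTop_nhds_zero_nat.div_const (N + 1)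
  have hΔ1 : ∀ n : ℕ, ENNReal.ofReal (Δ n) * (((n + 1 : ℕ) : ℝ≥0∞) * μ univ) ≤ 1 := fun n => by
    rw [hμN, ← ENNReal.ofReal_natCast, ← ENNReal.ofReal_mul (by positivity),
      ← ENNReal.ofReal_mul (hΔ0 n).le, ENNReal.ofReal_le_one, hΔ]
    push_cast
    rw [div_div, div_mul_eq_mul_div, div_le_one (by positivity)]
    nlinarith [(Nat.cast_nonneg n : (0 : ℝ) ≤ n)]
  choose Y hYm hYt hYu hYb hY using fun n : ℕ => exists_euler_approx
    (hk.truncate ((n + 1 : ℕ) : ℝ≥0∞)) (ENNReal.natCast_ne_top _) (fun p => min_le_right _ _)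
    (hΔ0 n) (hΔ1 n) rfl
  obtain ⟨φ, hφ, X, hXm, hX0, hX⟩ := exists_subseq_tendsto_ae_of_antitone hYm hYt hYu hYb
    (fun u hu => quant_ne_top hu)
  refine ⟨X, fun n t u => (Y (φ n) t u).toReal, fun n p => min (k p) ((φ n + 1 : ℕ) : ℝ≥0∞),
    fun n t => Δ (φ n) * ⌊t / Δ (φ n)⌋₊, ?_⟩
  constructor
  · exact hk
  · exact hkt
  · exact hkc
  · exact fun n => (hYm (φ n)).ennreal_toReal
  · exact hXm
  · exact fun n => hk.measurable.min measurable_const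
  · exact hX0
  · intro t
    filter_upwards [ae_restrict_of_ae (hX t), ae_restrict_mem measurableSet_Ioc] with u hu hu0
    exact hu hu0.1
  · exact fun n p => min_le_left _ _
  · intro p hp1 hp2 y hy
    have hlim : Tendsto (fun n => ((φ n + 1 : ℕ) : ℝ≥0∞)) atTop (𝓝 ∞) :=
      ENNReal.tendsto_nat_nhds_top.comp ((tendsto_add_atTop_nat 1).comp hφ.tendsto_atTop)
    have := ((hkc.continuousAt (prod_mem_nhds (Ioi_mem_nhds hp1)
      (Ioi_mem_nhds hp2))).tendsto.comp hy).min hlim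
    simpa using this
  · intro s t hst ht
    filter_upwards [(hΔlim.comp hφ.tendsto_atTop).eventually (gt_mem_nhds (sub_pos.2 hst))]
      with n hn
    have h1 := Nat.lt_floor_add_one (t / Δ (φ n))
    rw [div_lt_iff₀ (hΔ0 _)] at h1
    simp only [Function.comp] at hn
    linarith
  · exact fun n => hY (φ n)

/-- A Lipschitz approximation of the indicator of `(a, ∞)`. -/
noncomputable def ramp (a : ℝ) (n : ℕ) (x : ℝ) : ℝ := min 1 (max 0 (((n : ℝ) + 1) * (x - a)))

lemma ramp_monotone (a : ℝ) (n : ℕ) : Monotone (ramp a n) := fun x y hxy => by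
  unfold ramp
  gcongr

lemma ramp_eq_zero {a : ℝ} (n : ℕ) {x : ℝ} (hx : x ≤ a) : ramp a n x = 0 := by
  unfold ramp
  rw [max_eq_left (mul_nonpos_of_nonneg_of_nonpos (by positivity) (by linarith))]
  simp

lemma ramp_le_one (a : ℝ) (n : ℕ) (x : ℝ) : ramp a n x ≤ 1 := min_le_left _ _

lemma lipschitzWith_ramp (a : ℝ) (n : ℕ) : LipschitzWith ((n : ℝ≥0) + 1) (ramp a n) := by
  refine LipschitzWith.const_min (LipschitzWith.const_max (LipschitzWith.of_dist_le_mul ?_) 0) 1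
  intro x y
  rw [Real.dist_eq, Real.dist_eq, ← mul_sub, abs_mul, abs_of_nonneg (by positivity)]
  simp

lemma tendsto_ramp (a x : ℝ) :
    Tendsto (fun n => ENNReal.ofReal (ramp a n x)) atTop (𝓝 ((Ioi a).indicator 1 x)) := by
  by_cases hx : a < x
  · rw [indicator_of_mem (mem_Ioi.2 hx)]
    refine tendsto_const_nhds.congr' ?_
    obtain ⟨n₀, hn₀⟩ := exists_nat_one_div_lt (sub_pos.2 hx)
    filter_upwards [eventually_ge_atTop n₀] with n hn
    have h1 : 1 ≤ ((n : ℝ) + 1) * (x - a) := by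
      rw [div_lt_iff₀ (by positivity)] at hn₀
      have : (n₀ : ℝ) ≤ n := by exact_mod_cast hn
      nlinarith [sub_pos.2 hx]
    rw [ramp, min_eq_left (h1.trans (le_max_right _ _)), ENNReal.ofReal_one]
    rfl
  · rw [indicator_of_notMem (by simpa using hx)]
    simp [ramp_eq_zero _ (not_lt.1 hx)]

lemma restrict_Ioi_ext_of_lintegral {μ ν : Measure ℝ} [IsFiniteMeasure μ] [IsFiniteMeasure ν]
    (h : ∀ a > 0, ∀ n, ∫⁻ x, ENNReal.ofReal (ramp a n x) ∂μ
      = ∫⁻ x, ENNReal.ofReal (ramp a n x) ∂ν) :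
    μ.restrict (Ioi 0) = ν.restrict (Ioi 0) := by
  have key : ∀ (ρ : Measure ℝ) [IsFiniteMeasure ρ] (a : ℝ),
      Tendsto (fun n => ∫⁻ x, ENNReal.ofReal (ramp a n x) ∂ρ) atTop (𝓝 (ρ (Ioi a))) := by
    intro ρ _ a
    rw [← lintegral_indicator_one measurableSet_Ioi]
    exact tendsto_lintegral_of_dominated_convergence (fun _ => 1)
      (fun n => (lipschitzWith_ramp a n).continuous.measurable.ennreal_ofReal)
      (fun n => Eventually.of_forall fun u => ENNReal.ofReal_le_one.2 (ramp_le_one a n u))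
      (by simp) (Eventually.of_forall fun x => tendsto_ramp a x)
  refine restrict_Ioi_ext fun a ha => tendsto_nhds_unique (key μ a) ?_
  simp_rw [h a ha]
  exact key ν a

namespace IsApprox

variable {k : ℝ × ℝ → ℝ≥0∞} {μ m : Measure ℝ} {X : ℝ → ℝ → ℝ} {x : ℕ → ℝ → ℝ → ℝ}
  {κ : ℕ → ℝ × ℝ → ℝ≥0∞} {δ : ℕ → ℝ → ℝ}

lemma lintegral_ofReal_le [SFinite m] (H : IsApprox k μ m X x κ δ)
    (hmom : ∫⁻ x, ENNReal.ofReal x ∂μ ≠ ∞) {t : ℝ} (ht : 0 ≤ t) :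
    ∫⁻ u, ENNReal.ofReal (X t u) ∂m ≤ ∫⁻ x, ENNReal.ofReal x ∂μ := by
  refine le_self_add.trans (H.lintegral_add_le (ψ := fun _ => 0) ENNReal.measurable_ofReal
    measurable_const (fun x hx => ENNReal.ofReal_of_nonpos hx) hmom (fun x hx y hy => ?_)
    ENNReal.continuous_ofReal.continuousOn continuousOn_const (by simp) ht)
  rw [mul_zero, add_zero, ← ENNReal.ofReal_add hx.le hy.le]
  refine ENNReal.ofReal_le_ofReal ?_
  rw [abs_le]
  constructor <;> linarith

lemma lintegral_kernel_le [SFinite m] [IsFiniteMeasure μ] (H : IsApprox k μ m X x κ δ) {t : ℝ}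
    (ht : 0 ≤ t) :
    ∫⁻ ω, k (X ω.1 ω.2.1, X ω.1 ω.2.2) ∂((volume.restrict (Ico 0 t)).prod (m.prod m))
      ≤ 2 * μ univ := by
  have h := H.lintegral_add_le (h := (Ioi 0).indicator 1) (ψ := fun _ => 2⁻¹)
    (measurable_one.indicator measurableSet_Ioi) measurable_const (fun x hx => by simp [hx])
    (by rw [lintegral_indicator_one measurableSet_Ioi]; exact measure_ne_top _ _)
    (fun a ha b hb => by
      rw [ENNReal.mul_inv_cancel (by simp) (by simp), indicator_of_mem (mem_Ioi.2 ha),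
        indicator_of_mem (mem_Ioi.2 hb)]
      exact add_le_add (indicator_le_self' (fun _ _ => zero_le) _) le_rfl)
    ((continuousOn_const (c := (1 : ℝ≥0∞))).congr fun a ha => by simp [mem_Ioi.1 ha])
    continuousOn_const (by simp) ht
  have hkX : Measurable (fun ω : ℝ × ℝ × ℝ => k (X ω.1 ω.2.1, X ω.1 ω.2.2)) :=
    H.kernel.measurable.comp (measurable_pair H.meas_X)
  rw [lintegral_const_mul _ hkX] at h
  have h' := (le_add_self.trans h).trans (lintegral_mono
    (indicator_le_self' (s := Ioi 0) (f := (1 : ℝ → ℝ≥0∞)) fun _ _ => zero_le))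
  simp only [Pi.one_apply, lintegral_one] at h'
  calc _ = 2 * (2⁻¹ * ∫⁻ ω, k (X ω.1 ω.2.1, X ω.1 ω.2.2)
        ∂((volume.restrict (Ico 0 t)).prod (m.prod m))) := by
        rw [← mul_assoc, ENNReal.mul_inv_cancel (by simp) (by simp), one_mul]
    _ ≤ _ := by gcongr

lemma measure_add_eq [IsFiniteMeasure m] [IsFiniteMeasure μ] (H : IsApprox k μ m X x κ δ)
    (hmom : ∫⁻ x, ENNReal.ofReal x ∂μ ≠ ∞) {t : ℝ} (ht : 0 ≤ t) {B : Set ℝ} (hB : MeasurableSet B)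
    (hB0 : B ⊆ Ioi 0) :
    m (X t ⁻¹' B) + ∫⁻ ω, B.indicator 1 (X ω.1 ω.2.1) * k (X ω.1 ω.2.1, X ω.1 ω.2.2)
        ∂((volume.restrict (Ico 0 t)).prod (m.prod m))
      = μ B + ∫⁻ ω, B.indicator 1 (X ω.1 ω.2.1 - X ω.1 ω.2.2) * k (X ω.1 ω.2.1, X ω.1 ω.2.2)
        ∂((volume.restrict (Ico 0 t)).prod (m.prod m)) := by
  obtain ⟨M, hM⟩ : ∃ M, M = (volume.restrict (Ico 0 t)).prod (m.prod m) := ⟨_, rfl⟩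
  have hMf : SFinite M := hM ▸ inferInstance
  have hpair := measurable_pair H.meas_X
  have hkX : Measurable (fun ω : ℝ × ℝ × ℝ => k (X ω.1 ω.2.1, X ω.1 ω.2.2)) :=
    H.kernel.measurable.comp hpair
  have hX1 : Measurable (fun ω : ℝ × ℝ × ℝ => X ω.1 ω.2.1) := measurable_fst.comp hpair
  have hX2 : Measurable (fun ω : ℝ × ℝ × ℝ => X ω.1 ω.2.2) := measurable_snd.comp hpair
  have hXt : Measurable (X t) := H.meas_X.comp measurable_prodMk_left
  have hXd : Measurable (fun ω : ℝ × ℝ × ℝ => |X ω.1 ω.2.1 - X ω.1 ω.2.2|) := by fun_prop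
  have hle := H.lintegral_kernel_le ht
  rw [← hM] at hle ⊢
  obtain ⟨P, hP⟩ : ∃ P, P = M.withDensity (fun ω => k (X ω.1 ω.2.1, X ω.1 ω.2.2)) := ⟨_, rfl⟩
  have hPf : IsFiniteMeasure P := by
    refine ⟨?_⟩
    rw [hP, withDensity_apply _ MeasurableSet.univ, Measure.restrict_univ]
    exact hle.trans_lt (ENNReal.mul_lt_top (by simp) (measure_lt_top _ _))
  have hPi : ∀ g : ℝ × ℝ × ℝ → ℝ≥0∞, Measurable g →
      ∫⁻ ω, g ω ∂P = ∫⁻ ω, g ω * k (X ω.1 ω.2.1, X ω.1 ω.2.2) ∂M := fun g hg => by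
    rw [hP, lintegral_withDensity_eq_lintegral_mul _ hkX hg]
    simp only [Pi.mul_apply, mul_comm]
  have hident : ((2 : ℝ≥0∞) • m.map (X t) + (P.map (fun ω => X ω.1 ω.2.1)
      + P.map (fun ω => X ω.1 ω.2.2))).restrict (Ioi 0)
      = ((2 : ℝ≥0∞) • μ + P.map (fun ω => |X ω.1 ω.2.1 - X ω.1 ω.2.2|)).restrict (Ioi 0) := by
    have : IsFiniteMeasure ((2 : ℝ≥0∞) • m.map (X t)) := Measure.smul_finite _ (by simp)
    have : IsFiniteMeasure ((2 : ℝ≥0∞) • μ) := Measure.smul_finite _ (by simp)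
    refine restrict_Ioi_ext_of_lintegral fun a ha n => ?_
    have hhm : Measurable (fun x => ENNReal.ofReal (ramp a n x)) :=
      (lipschitzWith_ramp a n).continuous.measurable.ennreal_ofReal
    have hlm : Measurable (fun ω : ℝ × ℝ × ℝ =>
        ENNReal.ofReal (collisionLoss (ramp a n) (X ω.1 ω.2.1, X ω.1 ω.2.2))) :=
      ((continuous_collisionLoss (lipschitzWith_ramp a n).continuous).measurable.comp
        hpair).ennreal_ofReal
    have hr1 : Measurable (fun ω : ℝ × ℝ × ℝ => ENNReal.ofReal (ramp a n (X ω.1 ω.2.1))) :=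
      hhm.comp hX1
    have hr2 : Measurable (fun ω : ℝ × ℝ × ℝ => ENNReal.ofReal (ramp a n (X ω.1 ω.2.2))) :=
      hhm.comp hX2
    have hrd : Measurable (fun ω : ℝ × ℝ × ℝ =>
        ENNReal.ofReal (ramp a n |X ω.1 ω.2.1 - X ω.1 ω.2.2|)) := hhm.comp hXd
    have h1 := H.lintegral_add_eq hmom (ramp_monotone a n)
      (fun x hx => ramp_eq_zero n (hx.trans ha.le)) (ramp_le_one a n) (lipschitzWith_ramp a n)
      (by simp) ht
    rw [← hM, ← hPi _ hlm] at h1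
    rw [lintegral_add_measure, lintegral_add_measure, lintegral_add_measure, lintegral_smul_measure,
      lintegral_smul_measure, lintegral_map hhm hX1, lintegral_map hhm hX2, lintegral_map hhm hXd,
      lintegral_map hhm hXt, ← h1, smul_eq_mul, smul_eq_mul, mul_add, add_assoc]
    congr 1
    rw [← lintegral_const_mul _ hlm, ← lintegral_add_left hr1,
      ← lintegral_add_left (hlm.const_mul 2)]
    refine (hPi _ (hr1.add hr2)).trans (Eq.trans ?_ (hPi _ ((hlm.const_mul 2).add hrd)).symm)
    refine lintegral_congr fun ω => ?_
    simp only [Pi.add_apply]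
    rcases (H.X_nonneg ω.1 ω.2.1).eq_or_lt with h1 | h1
    · rw [H.kernel.eq_zero _ _ h1.ge, mul_zero, mul_zero]
    rcases (H.X_nonneg ω.1 ω.2.2).eq_or_lt with h2 | h2
    · rw [H.kernel.eq_zero_right _ _ h2.ge, mul_zero, mul_zero]
    rw [← ofReal_add_two_mul_collisionLoss (ramp_monotone a n)
      (fun x hx => ramp_eq_zero n (hx.trans ha.le)) h1 h2, add_comm (2 * _)]
  have hswap : ∀ g : ℝ × ℝ → ℝ≥0∞, Measurable g →
      ∫⁻ ω, g (X ω.1 ω.2.2, X ω.1 ω.2.1) * k (X ω.1 ω.2.1, X ω.1 ω.2.2) ∂M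
        = ∫⁻ ω, g (X ω.1 ω.2.1, X ω.1 ω.2.2) * k (X ω.1 ω.2.1, X ω.1 ω.2.2) ∂M := by
    intro g hg
    have hm1 : Measurable (fun ω : ℝ × ℝ × ℝ => g (X ω.1 ω.2.2, X ω.1 ω.2.1)
      * k (X ω.1 ω.2.1, X ω.1 ω.2.2)) := (hg.comp (hX2.prodMk hX1)).mul hkX
    have hm2 : Measurable (fun ω : ℝ × ℝ × ℝ => g (X ω.1 ω.2.1, X ω.1 ω.2.2)
      * k (X ω.1 ω.2.1, X ω.1 ω.2.2)) := (hg.comp hpair).mul hkX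
    rw [hM, lintegral_prod _ hm1.aemeasurable, lintegral_prod _ hm2.aemeasurable]
    congr 1 with s
    rw [← lintegral_prod_swap]
    congr 1 with p
    simp only [Prod.fst_swap, Prod.snd_swap]
    rw [H.kernel.symm]
  have hBm : Measurable (B.indicator (1 : ℝ → ℝ≥0∞)) := measurable_one.indicator hB
  have hB' := congrArg (fun ρ : Measure ℝ => ∫⁻ x, B.indicator 1 x ∂ρ) hident
  have hres : ∀ ρ : Measure ℝ, ∫⁻ x in Ioi 0, B.indicator 1 x ∂ρ = ∫⁻ x, B.indicator 1 x ∂ρ := by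
    intro ρ
    rw [lintegral_indicator_one hB, lintegral_indicator_one hB, Measure.restrict_apply hB,
      inter_eq_left.2 hB0]
  simp only [hres] at hB'
  have hb1 : Measurable (fun ω : ℝ × ℝ × ℝ => B.indicator (1 : ℝ → ℝ≥0∞) (X ω.1 ω.2.1)) :=
    hBm.comp hX1
  have hb2 : Measurable (fun ω : ℝ × ℝ × ℝ => B.indicator (1 : ℝ → ℝ≥0∞) (X ω.1 ω.2.2)) :=
    hBm.comp hX2
  have hbd : Measurable (fun ω : ℝ × ℝ × ℝ =>
    B.indicator (1 : ℝ → ℝ≥0∞) |X ω.1 ω.2.1 - X ω.1 ω.2.2|) := hBm.comp hXd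
  rw [lintegral_add_measure, lintegral_add_measure, lintegral_add_measure, lintegral_smul_measure,
      lintegral_smul_measure, lintegral_map hBm hX1, lintegral_map hBm hX2, lintegral_map hBm hXd,
      lintegral_indicator_one hB, lintegral_indicator_one hB, Measure.map_apply hXt hB,
      smul_eq_mul, smul_eq_mul, hPi _ hb1, hPi _ hb2, hPi _ hbd]
    at hB'
  have e1 := hswap (fun p => B.indicator 1 p.1) (hBm.comp measurable_fst)
  have e2 := hswap (fun p => B.indicator 1 (p.1 - p.2))
    (hBm.comp (measurable_fst.sub measurable_snd))
  have e3 : ∫⁻ ω, B.indicator 1 |X ω.1 ω.2.1 - X ω.1 ω.2.2| * k (X ω.1 ω.2.1, X ω.1 ω.2.2) ∂M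
      = ∫⁻ ω, B.indicator 1 (X ω.1 ω.2.1 - X ω.1 ω.2.2) * k (X ω.1 ω.2.1, X ω.1 ω.2.2) ∂M
      + ∫⁻ ω, B.indicator 1 (X ω.1 ω.2.2 - X ω.1 ω.2.1) * k (X ω.1 ω.2.1, X ω.1 ω.2.2) ∂M := by
    have hb12 : Measurable (fun ω : ℝ × ℝ × ℝ =>
        B.indicator (1 : ℝ → ℝ≥0∞) (X ω.1 ω.2.1 - X ω.1 ω.2.2) * k (X ω.1 ω.2.1, X ω.1 ω.2.2)) :=
      (hBm.comp (hX1.sub hX2)).mul hkX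
    rw [← lintegral_add_left hb12]
    congr 1 with ω
    rw [← add_mul]
    congr 1
    have hneg : ∀ z ≤ 0, B.indicator (1 : ℝ → ℝ≥0∞) z = 0 := fun z hz =>
      indicator_of_notMem (fun h => absurd (hB0 h) (not_lt.2 hz)) _
    rcases le_total (X ω.1 ω.2.2) (X ω.1 ω.2.1) with h | h
    · rw [abs_of_nonneg (sub_nonneg.2 h), hneg (X ω.1 ω.2.2 - X ω.1 ω.2.1) (by linarith), add_zero]
    · rw [abs_of_nonpos (sub_nonpos.2 h), hneg (X ω.1 ω.2.1 - X ω.1 ω.2.2) (by linarith), zero_add,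
        neg_sub]
  simp only at e1 e2
  rw [e3, e1, e2, ← two_mul, ← two_mul, ← mul_add, ← mul_add] at hB'
  exact (ENNReal.mul_right_inj (by simp) (by simp)).1 hB'

end IsApprox

/-- A measure-valued solution of the weak coagulation equation with initial datum `μ`. -/
structure IsWeakSolution (k : ℝ × ℝ → ℝ≥0∞) (μ : Measure ℝ)
    (κ : ProbabilityTheory.Kernel ℝ ℝ) : Prop where
  kernel : IsCollisionKernel k
  support : ∀ t, κ t (Iic 0) = 0
  mass_le : ∀ t, κ t univ ≤ μ univ
  moment_le : ∀ t ≥ 0, ∫⁻ x, ENNReal.ofReal x ∂(κ t) ≤ ∫⁻ x, ENNReal.ofReal x ∂μ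
  collisions_le : ∀ t ≥ 0, ∫⁻ s in Ico 0 t, ∫⁻ p, k p ∂((κ s).prod (κ s)) ≤ 2 * μ univ
  measure_add_eq : ∀ t ≥ 0, ∀ B : Set ℝ, MeasurableSet B → B ⊆ Ioi 0 →
    κ t B + ∫⁻ s in Ico 0 t, ∫⁻ p, B.indicator 1 p.1 * k p ∂((κ s).prod (κ s))
      = μ B + ∫⁻ s in Ico 0 t, ∫⁻ p, B.indicator 1 (p.1 - p.2) * k p ∂((κ s).prod (κ s))

lemma lintegral_map_restrict_prod {k : ℝ × ℝ → ℝ≥0∞} (hk : IsCollisionKernel k) {m : Measure ℝ}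
    [IsFiniteMeasure m] {X : ℝ → ℝ → ℝ} (hX : Measurable (Function.uncurry X)) {g : ℝ × ℝ → ℝ≥0∞}
    (hg : Measurable g) (t : ℝ) :
    ∫⁻ s in Ico 0 t, ∫⁻ p, g p * k p
        ∂(((m.map (X s)).restrict (Ioi 0)).prod ((m.map (X s)).restrict (Ioi 0)))
      = ∫⁻ ω, g (X ω.1 ω.2.1, X ω.1 ω.2.2) * k (X ω.1 ω.2.1, X ω.1 ω.2.2)
        ∂((volume.restrict (Ico 0 t)).prod (m.prod m)) := by
  have hgk : Measurable (fun p => g p * k p) := hg.mul hk.measurable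
  have hm : Measurable (fun ω : ℝ × ℝ × ℝ => g (X ω.1 ω.2.1, X ω.1 ω.2.2)
      * k (X ω.1 ω.2.1, X ω.1 ω.2.2)) := hgk.comp (measurable_pair hX)
  rw [lintegral_prod _ hm.aemeasurable]
  congr 1 with s
  have hs : Measurable (X s) := hX.comp measurable_prodMk_left
  rw [Measure.prod_restrict, ← lintegral_indicator (measurableSet_Ioi.prod measurableSet_Ioi),
    Measure.map_prod_map _ _ hs hs]
  have hind : (Ioi (0 : ℝ) ×ˢ Ioi (0 : ℝ)).indicator (fun p => g p * k p) = fun p => g p * k p := by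
    refine indicator_eq_self.2 fun p hp => ?_
    by_contra h
    rw [mem_prod, not_and_or] at h
    refine hp ?_
    have hkp : k (p.1, p.2) = 0 := h.elim (fun h => hk.eq_zero _ _ (not_lt.1 h))
      fun h => hk.eq_zero_right _ _ (not_lt.1 h)
    exact mul_eq_zero_of_right _ hkp
  rw [hind, lintegral_map hgk (hs.prodMap hs)]
  rfl

theorem exists_isWeakSolution {k : ℝ × ℝ → ℝ≥0∞} (hk : IsCollisionKernel k)
    (hkt : ∀ p, k p ≠ ∞) (hkc : ContinuousOn k (Ioi 0 ×ˢ Ioi 0)) (μ : Measure ℝ)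
    [IsFiniteMeasure μ] (hmom : ∫⁻ x, ENNReal.ofReal x ∂μ ≠ ∞) :
    ∃ κ : ProbabilityTheory.Kernel ℝ ℝ, IsWeakSolution k μ κ := by
  obtain ⟨X, x, κ, δ, H⟩ := exists_isApprox hk hkt hkc μ
  obtain ⟨m, hm⟩ : ∃ m : Measure ℝ, m = volume.restrict (Ioc 0 (μ univ).toReal) := ⟨_, rfl⟩
  have hmf : IsFiniteMeasure m := by rw [hm]; infer_instance
  have hmu : m univ = μ univ := by
    rw [hm, Measure.restrict_apply_univ, Real.volume_Ioc, sub_zero,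
      ENNReal.ofReal_toReal (measure_ne_top _ _)]
  rw [← hm] at H
  have hX : ∀ t, Measurable (X t) := fun t => H.meas_X.comp measurable_prodMk_left
  refine ⟨⟨fun s => (m.map (X s)).restrict (Ioi 0),
    Measure.measurable_of_measurable_coe _ fun B hB => ?_⟩, hk, fun t => ?_, fun t => ?_,
    fun t ht => ?_, fun t ht => ?_, fun t ht B hB hB0 => ?_⟩
  · have h1 : ∀ s, (m.map (X s)).restrict (Ioi 0) B
        = m (Prod.mk s ⁻¹' (Function.uncurry X ⁻¹' (B ∩ Ioi 0))) := fun s => by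
      rw [Measure.restrict_apply hB, Measure.map_apply (hX s) (hB.inter measurableSet_Ioi)]
      rfl
    refine Eq.mpr (congrArg Measurable (funext h1)) ?_
    exact measurable_measure_prodMk_left (H.meas_X (hB.inter measurableSet_Ioi))
  · change (m.map (X t)).restrict (Ioi 0) (Iic 0) = 0
    rw [Measure.restrict_apply measurableSet_Iic, Iic_inter_Ioi, Ioc_self, measure_empty]
  · change (m.map (X t)).restrict (Ioi 0) univ ≤ _
    rw [Measure.restrict_apply_univ]
    refine (measure_mono (subset_univ _)).trans ?_
    rw [Measure.map_apply (hX t) MeasurableSet.univ, preimage_univ, hmu]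
  · change ∫⁻ x in Ioi 0, ENNReal.ofReal x ∂(m.map (X t)) ≤ _
    refine (setLIntegral_le_lintegral _ _).trans ?_
    rw [lintegral_map ENNReal.measurable_ofReal (hX t)]
    exact H.lintegral_ofReal_le hmom ht
  · have := lintegral_map_restrict_prod (m := m) hk H.meas_X (g := fun _ => 1) measurable_const t
    simp only [one_mul] at this
    exact this.trans_le (H.lintegral_kernel_le ht)
  · have hBm : Measurable (B.indicator (1 : ℝ → ℝ≥0∞)) := measurable_one.indicator hB
    have h1 := lintegral_map_restrict_prod (m := m) hk H.meas_X
      (g := fun p => B.indicator 1 p.1) (hBm.comp measurable_fst) t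
    have h2 := lintegral_map_restrict_prod (m := m) hk H.meas_X
      (g := fun p => B.indicator 1 (p.1 - p.2))
      (hBm.comp (measurable_fst.sub measurable_snd)) t
    have h3 : (m.map (X t)).restrict (Ioi 0) B = m (X t ⁻¹' B) := by
      rw [Measure.restrict_apply hB, inter_eq_left.2 hB0, Measure.map_apply (hX t) hB]
    have h4 := H.measure_add_eq hmom ht hB hB0
    rw [← h1, ← h2, ← h3] at h4
    exact h4

lemma setLIntegral_Ico_add (F : ℝ → ℝ≥0∞) {a b c : ℝ} (hab : a ≤ b) (hbc : b ≤ c) :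
    (∫⁻ s in Ico a b, F s) + ∫⁻ s in Ico b c, F s = ∫⁻ s in Ico a c, F s := by
  rw [← Ico_union_Ico_eq_Ico hab hbc, lintegral_union measurableSet_Ico]
  exact (Iio_disjoint_Ici le_rfl).mono Ico_subset_Iio_self Ico_subset_Ici_self

lemma tendsto_setLIntegral_Ico {F : ℝ → ℝ≥0∞} {T : ℝ} (hF : ∫⁻ s in Ico 0 T, F s ≠ ∞)
    {ι : Type*} {l : Filter ι} {a b : ι → ℝ} {c : ℝ} (ha : Tendsto a l (𝓝 c))
    (hb : Tendsto b l (𝓝 c)) (h0 : ∀ᶠ i in l, 0 ≤ a i) (h1 : ∀ᶠ i in l, b i ≤ T) :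
    Tendsto (fun i => ∫⁻ s in Ico (a i) (b i), F s) l (𝓝 0) := by
  have h := tendsto_setLIntegral_zero (l := l) (s := fun i => Ico (a i) (b i)) hF ?_
  · refine h.congr' ?_
    filter_upwards [h0, h1] with i h0 h1
    rw [Measure.restrict_restrict measurableSet_Ico,
      inter_eq_left.2 (Ico_subset_Ico h0 h1)]
  · have h2 : Tendsto (fun i => ENNReal.ofReal (b i - a i)) l (𝓝 0) := by
      have := ENNReal.tendsto_ofReal (hb.sub ha)
      rwa [sub_self, ENNReal.ofReal_zero] at this
    refine tendsto_of_tendsto_of_tendsto_of_le_of_le tendsto_const_nhds h2 (fun _ => zero_le)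
      fun i => ?_
    exact (Measure.restrict_apply_le _ _).trans_eq Real.volume_Ico

namespace IsWeakSolution

variable {k : ℝ × ℝ → ℝ≥0∞} {μ : Measure ℝ} {κ : ProbabilityTheory.Kernel ℝ ℝ}

lemma isFiniteKernel [IsFiniteMeasure μ] (W : IsWeakSolution k μ κ) :
    ProbabilityTheory.IsFiniteKernel κ :=
  ⟨⟨μ univ, measure_lt_top _ _, W.mass_le⟩⟩

lemma lintegral_indicator_mul_le (κ : ProbabilityTheory.Kernel ℝ ℝ) (B : Set ℝ) (φ : ℝ × ℝ → ℝ)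
    (s : ℝ) : ∫⁻ p, B.indicator 1 (φ p) * k p ∂((κ s).prod (κ s))
      ≤ ∫⁻ p, k p ∂((κ s).prod (κ s)) :=
  lintegral_mono fun _ => mul_le_of_le_one_left' (indicator_le_self' (fun _ _ => zero_le) _)

lemma loss_ne_top [IsFiniteMeasure μ] (W : IsWeakSolution k μ κ) {t : ℝ} (ht : 0 ≤ t)
    (B : Set ℝ) (φ : ℝ × ℝ → ℝ) :
    ∫⁻ s in Ico 0 t, ∫⁻ p, B.indicator 1 (φ p) * k p ∂((κ s).prod (κ s)) ≠ ∞ :=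
  (((lintegral_mono fun s => lintegral_indicator_mul_le κ B φ s).trans
    (W.collisions_le t ht)).trans_lt (ENNReal.mul_lt_top (by simp) (measure_lt_top _ _))).ne

lemma measure_le_add [IsFiniteMeasure μ] (W : IsWeakSolution k μ κ) {q t : ℝ} (hq : 0 ≤ q)
    (hqt : q ≤ t) {B : Set ℝ} (hB : MeasurableSet B) (hB0 : B ⊆ Ioi 0) :
    κ t B ≤ κ q B + ∫⁻ s in Ico q t, ∫⁻ p, k p ∂((κ s).prod (κ s)) := by
  have h1 := W.measure_add_eq t (hq.trans hqt) B hB hB0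
  have h2 := W.measure_add_eq q hq B hB hB0
  rw [← setLIntegral_Ico_add (fun s => ∫⁻ p, B.indicator 1 (p.1 - p.2) * k p ∂((κ s).prod (κ s)))
    hq hqt, ← add_assoc, ← h2] at h1
  refine (ENNReal.add_le_add_iff_right (W.loss_ne_top (hq.trans hqt) B Prod.fst)).1 ?_
  rw [h1, add_right_comm]
  gcongr
  exact mul_le_of_le_one_left' (indicator_le_self' (fun _ _ => zero_le) _)

lemma absolutelyContinuous [IsFiniteMeasure μ] (W : IsWeakSolution k μ κ) (hμ : μ ≪ volume)
    {t : ℝ} (ht : 0 ≤ t) : κ t ≪ volume := by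
  have hκ := W.isFiniteKernel
  have hex : ∀ q : ℚ, ∃ N : Set ℝ, MeasurableSet N ∧ volume N = 0 ∧
      ∀ B : Set ℝ, volume B = 0 → κ q (B \ N) = 0 := by
    intro q
    obtain ⟨S, hSm, hS0, hSc⟩ := (κ q).mutuallySingular_singularPart volume
    refine ⟨Sᶜ, hSm.compl, hSc, fun B hB => ?_⟩
    rw [sdiff_eq, compl_compl, Measure.haveLebesgueDecomposition_add (κ q) volume,
      Measure.add_apply, measure_mono_null inter_subset_right hS0, zero_add]
    exact withDensity_absolutelyContinuous _ _ (measure_mono_null inter_subset_left hB)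
  choose N hNm hN0 hN using hex
  obtain ⟨E, hE⟩ : ∃ E, E = (⋃ q, N q) ∩ Ioi 0 := ⟨_, rfl⟩
  have hEm : MeasurableSet E := hE ▸ (MeasurableSet.iUnion hNm).inter measurableSet_Ioi
  have hE0 : volume E = 0 :=
    hE ▸ measure_mono_null inter_subset_left (measure_iUnion_null hN0)
  have hEpos : E ⊆ Ioi 0 := hE ▸ inter_subset_right
  have hdiff : ∀ B ⊆ Ioi (0 : ℝ), MeasurableSet B → volume B = 0 → ∀ s ≥ 0, κ s (B \ E) = 0 := by
    intro B hBpos hBm hB0 s hs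
    have hq : ∀ q : ℚ, κ q (B \ E) = 0 := fun q => by
      have hsub : B \ E ⊆ B \ N q := fun x hx =>
        ⟨hx.1, fun hxN => hx.2 (hE ▸ ⟨mem_iUnion.2 ⟨q, hxN⟩, hBpos hx.1⟩)⟩
      exact measure_mono_null hsub (hN q B hB0)
    rcases hs.eq_or_lt with h0 | h0
    · simpa [h0] using hq 0
    refine le_antisymm (le_of_forall_gt fun ε hε => ?_) zero_le
    have hlim := tendsto_setLIntegral_Ico
      ((W.collisions_le s hs).trans_lt (ENNReal.mul_lt_top (by simp) (measure_lt_top _ _))).ne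
      (l := 𝓝[<] s) (a := fun q => q) (b := fun _ => s) (c := s)
      (tendsto_id.mono_left nhdsWithin_le_nhds) tendsto_const_nhds
      (eventually_nhdsWithin_of_eventually_nhds ((lt_mem_nhds h0).mono fun _ h => h.le))
      (Eventually.of_forall fun _ => le_rfl)
    obtain ⟨a, ha, has⟩ := (mem_nhdsLT_iff_exists_Ioo_subset' (show s - 1 < s by linarith)).1
      (hlim.eventually (gt_mem_nhds hε))
    obtain ⟨q, hq1, hq2⟩ := exists_rat_btwn (max_lt ha h0)
    have h := W.measure_le_add ((le_max_right a 0).trans hq1.le) hq2.le (hBm.diff hEm)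
      (sdiff_subset.trans hBpos)
    rw [hq, zero_add] at h
    exact h.trans_lt (has ⟨(le_max_left _ _).trans_lt hq1, hq2⟩)
  have hkm := W.kernel.measurable
  have hgain : ∀ s ≥ 0, ∫⁻ p, E.indicator 1 (p.1 - p.2) * k p ∂((κ s).prod (κ s))
      ≤ ∫⁻ p, E.indicator 1 p.1 * k p ∂((κ s).prod (κ s)) := by
    intro s hs
    have hEi : Measurable (E.indicator (1 : ℝ → ℝ≥0∞)) := measurable_one.indicator hEm
    have hm1 : Measurable (fun p : ℝ × ℝ => E.indicator (1 : ℝ → ℝ≥0∞) (p.1 - p.2) * k p) :=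
      (hEi.comp (measurable_fst.sub measurable_snd)).mul hkm
    have hm2 : Measurable (fun p : ℝ × ℝ => E.indicator (1 : ℝ → ℝ≥0∞) p.1 * k p) :=
      (hEi.comp measurable_fst).mul hkm
    rw [lintegral_prod_symm _ hm1.aemeasurable, lintegral_prod_symm _ hm2.aemeasurable]
    refine lintegral_mono fun y => lintegral_mono_ae ?_
    rcases le_or_gt y 0 with hy | hy
    · refine Eventually.of_forall fun x => ?_
      simp only [W.kernel.eq_zero_right _ _ hy, mul_zero, le_refl]
    have hpre : MeasurableSet ((fun x => x - y) ⁻¹' E) := hEm.preimage (measurable_id.sub_const y)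
    have hnull := hdiff ((fun x => x - y) ⁻¹' E) (fun x hx => ?_) hpre ?_ s hs
    · filter_upwards [measure_eq_zero_iff_ae_notMem.1 hnull] with x hx
      refine mul_le_mul_left ?_ _
      by_cases hxE : x ∈ E
      · rw [indicator_of_mem hxE]
        exact indicator_le_self' (fun _ _ => zero_le) _
      · have hxy : x - y ∉ E := fun h => hx ⟨h, hxE⟩
        rw [indicator_of_notMem hxy]
        exact zero_le
    · have := mem_Ioi.1 (hEpos hx)
      exact mem_Ioi.2 (by linarith)
    · rw [(measurePreserving_sub_right volume y).measure_preimage hEm.nullMeasurableSet, hE0]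
  have hκE : κ t E = 0 := by
    have h := W.measure_add_eq t ht E hEm hEpos
    rw [hμ hE0, zero_add] at h
    have h' := h.trans_le (setLIntegral_mono' measurableSet_Ico fun s hs => hgain s hs.1)
    have hne := W.loss_ne_top ht E Prod.fst
    have hle := (ENNReal.add_le_add_iff_right hne).1 (h'.trans_eq (zero_add _).symm)
    exact le_antisymm hle zero_le
  refine Measure.AbsolutelyContinuous.mk fun B hB hB0 => ?_
  have hsub : B ⊆ Iic 0 ∪ ((B ∩ Ioi 0) \ E ∪ E) := by
    intro x hx
    by_cases hxE : x ∈ E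
    · exact Or.inr (Or.inr hxE)
    rcases le_or_gt x 0 with h | h
    · exact Or.inl h
    · exact Or.inr (Or.inl ⟨⟨hx, h⟩, hxE⟩)
  refine measure_mono_null hsub (measure_union_null (W.support t) (measure_union_null ?_ hκE))
  exact hdiff _ inter_subset_right (hB.inter measurableSet_Ioi)
    (measure_mono_null inter_subset_left hB0) t ht

end IsWeakSolution

/-- The rate at which particles of size `x` disappear. -/
noncomputable def lossRate (k : ℝ × ℝ → ℝ≥0∞) (g : ℝ → ℝ≥0∞) (x : ℝ) : ℝ≥0∞ :=
  ∫⁻ y, k (x, y) * (g x * g y)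

/-- The rate at which particles of size `x` are created. -/
noncomputable def gainRate (k : ℝ × ℝ → ℝ≥0∞) (g : ℝ → ℝ≥0∞) (x : ℝ) : ℝ≥0∞ :=
  ∫⁻ y, k (x + y, y) * (g (x + y) * g y)

lemma measurable_lossRate {k : ℝ × ℝ → ℝ≥0∞} (hk : Measurable k) {g : ℝ → ℝ → ℝ≥0∞}
    (hg : Measurable (Function.uncurry g)) :
    Measurable (fun p : ℝ × ℝ => lossRate k (g p.1) p.2) := by
  have h1 : Measurable (fun q : (ℝ × ℝ) × ℝ => k (q.1.2, q.2)) := by fun_prop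
  have h2 : Measurable (fun q : (ℝ × ℝ) × ℝ => g q.1.1 q.1.2) := hg.comp measurable_fst
  have h3 : Measurable (fun q : (ℝ × ℝ) × ℝ => g q.1.1 q.2) :=
    hg.comp (measurable_fst.fst.prodMk measurable_snd)
  exact (h1.mul (h2.mul h3)).lintegral_prod_right'

lemma measurable_gainRate {k : ℝ × ℝ → ℝ≥0∞} (hk : Measurable k) {g : ℝ → ℝ → ℝ≥0∞}
    (hg : Measurable (Function.uncurry g)) :
    Measurable (fun p : ℝ × ℝ => gainRate k (g p.1) p.2) := by
  have h1 : Measurable (fun q : (ℝ × ℝ) × ℝ => k (q.1.2 + q.2, q.2)) := by fun_prop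
  have h2 : Measurable (fun q : (ℝ × ℝ) × ℝ => g q.1.1 (q.1.2 + q.2)) :=
    hg.comp (measurable_fst.fst.prodMk (measurable_fst.snd.add measurable_snd))
  have h3 : Measurable (fun q : (ℝ × ℝ) × ℝ => g q.1.1 q.2) :=
    hg.comp (measurable_fst.fst.prodMk measurable_snd)
  exact (h1.mul (h2.mul h3)).lintegral_prod_right'

lemma lintegral_withDensity_prod {g : ℝ → ℝ≥0∞} (hg : Measurable g) {F : ℝ × ℝ → ℝ≥0∞}
    (hF : Measurable F) :
    ∫⁻ p, F p ∂((volume.withDensity g).prod (volume.withDensity g))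
      = ∫⁻ p, F p * (g p.1 * g p.2) ∂(volume.prod volume) := by
  rw [prod_withDensity hg hg, lintegral_withDensity_eq_lintegral_mul _ (by fun_prop) hF]
  simp only [Pi.mul_apply, mul_comm]

lemma setLIntegral_lossRate {k : ℝ × ℝ → ℝ≥0∞} (hk : Measurable k) {g : ℝ → ℝ≥0∞}
    (hg : Measurable g) {B : Set ℝ} (hB : MeasurableSet B) :
    ∫⁻ x in B, lossRate k g x
      = ∫⁻ p, B.indicator 1 p.1 * k p ∂((volume.withDensity g).prod (volume.withDensity g)) := by
  have hBm : Measurable (fun p : ℝ × ℝ => B.indicator (1 : ℝ → ℝ≥0∞) p.1) :=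
    (measurable_one.indicator hB).comp measurable_fst
  have hF : Measurable (fun p : ℝ × ℝ => B.indicator (1 : ℝ → ℝ≥0∞) p.1 * k p) := hBm.mul hk
  rw [lintegral_withDensity_prod hg hF, lintegral_prod _ (by fun_prop), ← lintegral_indicator hB]
  congr 1 with x
  by_cases hx : x ∈ B
  · simp [hx, lossRate]
  · simp [hx]

lemma setLIntegral_gainRate {k : ℝ × ℝ → ℝ≥0∞} (hk : Measurable k) {g : ℝ → ℝ≥0∞}
    (hg : Measurable g) {B : Set ℝ} (hB : MeasurableSet B) :
    ∫⁻ x in B, gainRate k g x = ∫⁻ p, B.indicator 1 (p.1 - p.2) * k p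
      ∂((volume.withDensity g).prod (volume.withDensity g)) := by
  have hBi : Measurable (B.indicator (1 : ℝ → ℝ≥0∞)) := measurable_one.indicator hB
  have hBm : Measurable (fun p : ℝ × ℝ => B.indicator (1 : ℝ → ℝ≥0∞) (p.1 - p.2)) :=
    hBi.comp (measurable_fst.sub measurable_snd)
  have hF : Measurable (fun p : ℝ × ℝ => B.indicator (1 : ℝ → ℝ≥0∞) (p.1 - p.2) * k p) :=
    hBm.mul hk
  have hG : Measurable (Function.uncurry fun x y : ℝ =>
      B.indicator (1 : ℝ → ℝ≥0∞) x * k (x + y, y) * (g (x + y) * g y)) := by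
    have h1 : Measurable (fun p : ℝ × ℝ => B.indicator (1 : ℝ → ℝ≥0∞) p.1) :=
      hBi.comp measurable_fst
    simp only [Function.uncurry_def]
    fun_prop
  have hsub : ∀ y : ℝ, ∫⁻ x, B.indicator 1 (x - y) * k (x, y) * (g x * g y)
      = ∫⁻ x, B.indicator 1 x * k (x + y, y) * (g (x + y) * g y) := fun y => by
    rw [← lintegral_add_right_eq_self _ y]
    simp only [add_sub_cancel_right]
  rw [lintegral_withDensity_prod hg hF, lintegral_prod_symm _ (by fun_prop),
    lintegral_congr hsub, ← lintegral_lintegral_swap hG.aemeasurable, ← lintegral_indicator hB]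
  congr 1 with x
  by_cases hx : x ∈ B
  · simp [hx, gainRate]
  · simp [hx]

/-- A density solution of the coagulation equation with initial density `f₀`. -/
structure IsDensitySolution (k : ℝ × ℝ → ℝ≥0∞) (f₀ : ℝ → ℝ≥0∞) (g : ℝ → ℝ → ℝ≥0∞) : Prop where
  kernel : IsCollisionKernel k
  measurable : Measurable (Function.uncurry g)
  ne_top : ∀ t x, g t x ≠ ∞
  eq_zero : ∀ t, ∀ x ≤ 0, g t x = 0
  mass_le : ∀ t ≥ 0, ∫⁻ x, g t x ≤ ∫⁻ x, f₀ x
  moment_le : ∀ t ≥ 0, ∫⁻ x, ENNReal.ofReal x * g t x ≤ ∫⁻ x, ENNReal.ofReal x * f₀ x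
  loss_le : ∀ t ≥ 0, ∫⁻ x, ∫⁻ s in Ico 0 t, lossRate k (g s) x ≤ 2 * ∫⁻ x, f₀ x
  gain_le : ∀ t ≥ 0, ∀ a ∈ Icc 0 t, ∫⁻ x in Ioi 0, ∫⁻ s in Ico a t, gainRate k (g s) x
    ≤ ∫⁻ x, ∫⁻ s in Ico a t, lossRate k (g s) x
  add_eq : ∀ t ≥ 0, ∀ᵐ x ∂(volume.restrict (Ioi 0)),
    g t x + ∫⁻ s in Ico 0 t, lossRate k (g s) x = f₀ x + ∫⁻ s in Ico 0 t, gainRate k (g s) x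

namespace IsWeakSolution

variable {k : ℝ × ℝ → ℝ≥0∞} {μ : Measure ℝ} {κ : ProbabilityTheory.Kernel ℝ ℝ}

lemma exists_density [IsFiniteMeasure μ] (W : IsWeakSolution k μ κ) (hμ : μ ≪ volume) :
    ∃ g : ℝ → ℝ → ℝ≥0∞, Measurable (Function.uncurry g) ∧ (∀ t x, g t x ≠ ∞) ∧
      (∀ t, ∀ x ≤ 0, g t x = 0) ∧ ∀ t ≥ 0, κ t = volume.withDensity (g t) := by
  have hκ := W.isFiniteKernel
  have hmax : Measurable (fun t : ℝ => max t 0) := by fun_prop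
  obtain ⟨ν, hν⟩ : ∃ ν : Measure ℝ, ν = volume.toFinite := ⟨_, rfl⟩
  have hνf : IsFiniteMeasure ν := hν ▸ inferInstance
  have hνv : ν ≪ volume := hν ▸ toFinite_absolutelyContinuous _
  have hvν : volume ≪ ν := hν ▸ absolutelyContinuous_toFinite _
  obtain ⟨r, hr⟩ : ∃ r, r = (κ.comap _ hmax).rnDeriv (ProbabilityTheory.Kernel.const ℝ ν) :=
    ⟨_, rfl⟩
  have hrm : Measurable (Function.uncurry r) :=
    hr ▸ ProbabilityTheory.Kernel.measurable_rnDeriv _ _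
  have hκr : ∀ t ≥ 0, κ t = volume.withDensity (ν.rnDeriv volume * r t) := by
    intro t ht
    have hrt : Measurable (r t) := hrm.comp measurable_prodMk_left
    have h0 : (κ.comap _ hmax) t = κ t := by
      rw [ProbabilityTheory.Kernel.comap_apply, max_eq_left ht]
    have h := ProbabilityTheory.Kernel.withDensity_rnDeriv_eq (κ := κ.comap _ hmax)
      (η := ProbabilityTheory.Kernel.const ℝ ν) (a := t) (by
        rw [h0, ProbabilityTheory.Kernel.const_apply]
        exact (W.absolutelyContinuous hμ ht).trans hvν)
    rw [← hr, ProbabilityTheory.Kernel.withDensity_apply _ hrm, h0,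
      ProbabilityTheory.Kernel.const_apply] at h
    rw [withDensity_mul _ (Measure.measurable_rnDeriv _ _) hrt,
      Measure.withDensity_rnDeriv_eq _ _ hνv, h]
  have hm : Measurable (fun p : ℝ × ℝ => ν.rnDeriv volume p.2 * r p.1 p.2) :=
    ((Measure.measurable_rnDeriv _ _).comp measurable_snd).mul hrm
  obtain ⟨S, hSdef⟩ : ∃ S, S = {p : ℝ × ℝ | 0 < p.2 ∧ ν.rnDeriv volume p.2 * r p.1 p.2 ≠ ∞} :=
    ⟨_, rfl⟩
  have hS : MeasurableSet S := hSdef ▸ (measurableSet_lt measurable_const measurable_snd).inter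
    (hm (measurableSet_singleton _).compl)
  have hSmem : ∀ t x, (t, x) ∈ S ↔ 0 < x ∧ ν.rnDeriv volume x * r t x ≠ ∞ := by
    simp only [hSdef, mem_ofPred_eq, implies_true]
  refine ⟨fun t x => S.indicator (fun p => ν.rnDeriv volume p.2 * r p.1 p.2) (t, x),
    hm.indicator hS, fun t x => ?_, fun t x hx => ?_, fun t ht => ?_⟩
  · beta_reduce
    by_cases h : (t, x) ∈ S
    · rw [indicator_of_mem h]
      exact ((hSmem t x).1 h).2
    · rw [indicator_of_notMem h]
      exact ENNReal.zero_ne_top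
  · exact indicator_of_notMem (fun h => absurd ((hSmem t x).1 h).1 (not_lt.2 hx)) _
  · rw [hκr t ht]
    have hmt : Measurable (fun x => ν.rnDeriv volume x * r t x) := hm.comp measurable_prodMk_left
    have h1 : ∀ᵐ x, ν.rnDeriv volume x * r t x < ∞ := by
      refine ae_lt_top hmt ?_
      have := measure_ne_top (κ t) univ
      rw [hκr t ht, withDensity_apply _ MeasurableSet.univ, Measure.restrict_univ] at this
      exact this
    have h2 : ∀ᵐ x ∂(volume.restrict (Iic 0)), ν.rnDeriv volume x * r t x = 0 := by
      have := W.support t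
      rw [hκr t ht, withDensity_apply _ measurableSet_Iic] at this
      exact (lintegral_eq_zero_iff hmt).1 this
    refine withDensity_congr_ae ?_
    filter_upwards [h1, (ae_restrict_iff' measurableSet_Iic).1 h2] with x h1 h2
    rcases le_or_gt x 0 with hx | hx
    · rw [indicator_of_notMem fun h => absurd ((hSmem t x).1 h).1 (not_lt.2 hx)]
      exact h2 hx
    · rw [indicator_of_mem ((hSmem t x).2 ⟨hx, h1.ne⟩)]
      rfl

theorem exists_isDensitySolution {f₀ : ℝ → ℝ≥0∞} (hf₀ : Measurable f₀) (hf : ∫⁻ x, f₀ x ≠ ∞)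
    (W : IsWeakSolution k (volume.withDensity f₀) κ) : ∃ g, IsDensitySolution k f₀ g := by
  have hμuniv : (volume.withDensity f₀) univ = ∫⁻ x, f₀ x := by
    rw [withDensity_apply _ MeasurableSet.univ, Measure.restrict_univ]
  have hμ : IsFiniteMeasure (volume.withDensity f₀) := ⟨hμuniv ▸ hf.lt_top⟩
  obtain ⟨g, hgm, hgt, hg0, hg⟩ := W.exists_density (withDensity_absolutelyContinuous _ _)
  have hkm := W.kernel.measurable
  have hgs : ∀ s, Measurable (g s) := fun s => hgm.comp measurable_prodMk_left
  have hlm := measurable_lossRate hkm hgm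
  have hGm := measurable_gainRate hkm hgm
  have hloss : ∀ (a t : ℝ) (B : Set ℝ), 0 ≤ a → MeasurableSet B →
      ∫⁻ x in B, ∫⁻ s in Ico a t, lossRate k (g s) x
        = ∫⁻ s in Ico a t, ∫⁻ p, B.indicator 1 p.1 * k p ∂((κ s).prod (κ s)) := by
    intro a t B ha hB
    rw [lintegral_lintegral_swap (f := fun x s => lossRate k (g s) x)
      (hlm.comp measurable_swap).aemeasurable]
    refine setLIntegral_congr_fun measurableSet_Ico fun s hs => ?_
    rw [setLIntegral_lossRate hkm (hgs s) hB, hg s (ha.trans hs.1)]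
  have hgain : ∀ (a t : ℝ) (B : Set ℝ), 0 ≤ a → MeasurableSet B →
      ∫⁻ x in B, ∫⁻ s in Ico a t, gainRate k (g s) x
        = ∫⁻ s in Ico a t, ∫⁻ p, B.indicator 1 (p.1 - p.2) * k p ∂((κ s).prod (κ s)) := by
    intro a t B ha hB
    rw [lintegral_lintegral_swap (f := fun x s => gainRate k (g s) x)
      (hGm.comp measurable_swap).aemeasurable]
    refine setLIntegral_congr_fun measurableSet_Ico fun s hs => ?_
    rw [setLIntegral_gainRate hkm (hgs s) hB, hg s (ha.trans hs.1)]
  have hlossu : ∀ (a t : ℝ), 0 ≤ a → ∫⁻ x, ∫⁻ s in Ico a t, lossRate k (g s) x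
      = ∫⁻ s in Ico a t, ∫⁻ p, k p ∂((κ s).prod (κ s)) := by
    intro a t ha
    have := hloss a t univ ha MeasurableSet.univ
    simpa only [Measure.restrict_univ, indicator_univ, Pi.one_apply, one_mul] using this
  refine ⟨g, W.kernel, hgm, hgt, hg0, fun t ht => ?_, fun t ht => ?_, fun t ht => ?_,
    fun t ht a ha => ?_, fun t ht => ?_⟩
  · have := W.mass_le t
    rwa [hμuniv, hg t ht, withDensity_apply _ MeasurableSet.univ, Measure.restrict_univ] at this
  · have := W.moment_le t ht
    rw [hg t ht, lintegral_withDensity_eq_lintegral_mul _ (hgs t) ENNReal.measurable_ofReal,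
      lintegral_withDensity_eq_lintegral_mul _ hf₀ ENNReal.measurable_ofReal] at this
    simpa only [Pi.mul_apply, mul_comm] using this
  · rw [hlossu 0 t le_rfl, ← hμuniv]
    exact W.collisions_le t ht
  · rw [hlossu a t ha.1, hgain a t _ ha.1 measurableSet_Ioi]
    exact lintegral_mono fun s => lintegral_indicator_mul_le κ _ _ s
  · have hL : Measurable (fun x => ∫⁻ s in Ico 0 t, lossRate k (g s) x) :=
      (hlm.comp measurable_swap).lintegral_prod_right'
    have hG : Measurable (fun x => ∫⁻ s in Ico 0 t, gainRate k (g s) x) :=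
      (hGm.comp measurable_swap).lintegral_prod_right'
    refine ae_eq_of_forall_setLIntegral_eq_of_sigmaFinite ((hgs t).add hL) (hf₀.add hG)
      fun B hB _ => ?_
    have hB' := hB.inter (measurableSet_Ioi (a := (0 : ℝ)))
    rw [Measure.restrict_restrict hB, lintegral_add_left (hgs t), lintegral_add_left hf₀,
      hloss 0 t _ le_rfl hB', hgain 0 t _ le_rfl hB', ← withDensity_apply _ hB',
      ← withDensity_apply _ hB', ← hg t ht]
    exact W.measure_add_eq t ht _ hB' inter_subset_right

end IsWeakSolution

lemma setLIntegral_eq_lintegral_of_zero {F : ℝ → ℝ≥0∞} (hF : ∀ x ≤ 0, F x = 0) :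
    ∫⁻ x in Ioi 0, F x = ∫⁻ x, F x := by
  have h : (Ioi (0 : ℝ)).indicator F = F := indicator_eq_self.2 fun y hy => by
    by_contra h
    exact hy (hF y (not_lt.1 h))
  rw [← lintegral_indicator measurableSet_Ioi, h]

namespace IsDensitySolution

variable {k : ℝ × ℝ → ℝ≥0∞} {f₀ : ℝ → ℝ≥0∞} {g : ℝ → ℝ → ℝ≥0∞}

lemma measurable_slice (D : IsDensitySolution k f₀ g) (t : ℝ) : Measurable (g t) :=
  D.measurable.comp measurable_prodMk_left

lemma measurable_loss (D : IsDensitySolution k f₀ g) (a t : ℝ) :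
    Measurable (fun x => ∫⁻ s in Ico a t, lossRate k (g s) x) :=
  ((measurable_lossRate D.kernel.measurable D.measurable).comp
    measurable_swap).lintegral_prod_right'

lemma measurable_gain (D : IsDensitySolution k f₀ g) (a t : ℝ) :
    Measurable (fun x => ∫⁻ s in Ico a t, gainRate k (g s) x) :=
  ((measurable_gainRate D.kernel.measurable D.measurable).comp
    measurable_swap).lintegral_prod_right'

lemma lintegral_loss_ne_top (D : IsDensitySolution k f₀ g) (hf : ∫⁻ x, f₀ x ≠ ∞) {t : ℝ}
    (ht : 0 ≤ t) : ∫⁻ x, ∫⁻ s in Ico 0 t, lossRate k (g s) x ≠ ∞ :=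
  ((D.loss_le t ht).trans_lt (ENNReal.mul_lt_top (by simp) hf.lt_top)).ne

lemma ae_loss_lt_top (D : IsDensitySolution k f₀ g) (hf : ∫⁻ x, f₀ x ≠ ∞) {t : ℝ}
    (ht : 0 ≤ t) : ∀ᵐ x, ∫⁻ s in Ico 0 t, lossRate k (g s) x < ∞ :=
  ae_lt_top (D.measurable_loss 0 t) (D.lintegral_loss_ne_top hf ht)

lemma ae_gain_lt_top (D : IsDensitySolution k f₀ g) (hf : ∫⁻ x, f₀ x ≠ ∞) {t : ℝ}
    (ht : 0 ≤ t) :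
    ∀ᵐ x ∂(volume.restrict (Ioi 0)), ∫⁻ s in Ico 0 t, gainRate k (g s) x < ∞ :=
  ae_lt_top (D.measurable_gain 0 t) ((D.gain_le t ht 0 ⟨le_rfl, ht⟩).trans_lt
    (D.lintegral_loss_ne_top hf ht).lt_top).ne

lemma lintegral_abs_sub_le (D : IsDensitySolution k f₀ g) (hf : ∫⁻ x, f₀ x ≠ ∞) {a t : ℝ}
    (ha : 0 ≤ a) (hat : a ≤ t) :
    ∫⁻ x in Ioi 0, ENNReal.ofReal |(g t x).toReal - (g a x).toReal|
      ≤ 2 * ∫⁻ s in Ico a t, ∫⁻ x, lossRate k (g s) x := by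
  have ht := ha.trans hat
  have hswap : ∫⁻ s in Ico a t, ∫⁻ x, lossRate k (g s) x
      = ∫⁻ x, ∫⁻ s in Ico a t, lossRate k (g s) x :=
    lintegral_lintegral_swap (f := fun s x => lossRate k (g s) x)
      (measurable_lossRate D.kernel.measurable D.measurable).aemeasurable
  have hpt : ∀ᵐ x ∂(volume.restrict (Ioi 0)),
      ENNReal.ofReal |(g t x).toReal - (g a x).toReal|
        ≤ (∫⁻ s in Ico a t, lossRate k (g s) x) + ∫⁻ s in Ico a t, gainRate k (g s) x := by
    filter_upwards [D.add_eq t ht, D.add_eq a ha, ae_restrict_of_ae (D.ae_loss_lt_top hf ht),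
      D.ae_gain_lt_top hf ht] with x h1 h2 h3 h4
    rw [← setLIntegral_Ico_add _ ha hat] at h1 h3 h4
    rw [← setLIntegral_Ico_add _ ha hat, ← add_assoc, ← add_assoc, ← h2] at h1
    obtain ⟨hL0, hL⟩ := ENNReal.add_lt_top.1 h3
    have hG := (ENNReal.add_lt_top.1 h4).2
    rw [add_right_comm, add_right_comm (g a x)] at h1
    have h5 := (ENNReal.add_left_inj hL0.ne).1 h1
    have h6 := congrArg ENNReal.toReal h5
    rw [ENNReal.toReal_add (D.ne_top t x) hL.ne, ENNReal.toReal_add (D.ne_top a x) hG.ne] at h6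
    rw [← ENNReal.ofReal_toReal (ENNReal.add_lt_top.2 ⟨hL, hG⟩).ne, ENNReal.toReal_add hL.ne hG.ne]
    refine ENNReal.ofReal_le_ofReal (abs_le.2 ⟨?_, ?_⟩) <;>
    linarith [ENNReal.toReal_nonneg (a := ∫⁻ s in Ico a t, lossRate k (g s) x),
      ENNReal.toReal_nonneg (a := ∫⁻ s in Ico a t, gainRate k (g s) x)]
  refine (lintegral_mono_ae hpt).trans ?_
  rw [lintegral_add_left (D.measurable_loss a t), two_mul, hswap]
  exact add_le_add (setLIntegral_le_lintegral _ _) (D.gain_le t ht a ⟨ha, hat⟩)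

lemma tendsto_integral_abs_sub (D : IsDensitySolution k f₀ g) (hf : ∫⁻ x, f₀ x ≠ ∞) {t₀ : ℝ}
    (ht₀ : 0 ≤ t₀) :
    Tendsto (fun t => ∫ x in Ioi 0, |(g t x).toReal - (g t₀ x).toReal|)
      (𝓝[Ici 0] t₀) (𝓝 0) := by
  have hT : 0 ≤ t₀ + 1 := by linarith
  have hmin : Tendsto (fun t => min t t₀) (𝓝 t₀) (𝓝 t₀) := by
    simpa using (tendsto_id (x := 𝓝 t₀)).min (tendsto_const_nhds (x := t₀))
  have hmax : Tendsto (fun t => max t t₀) (𝓝 t₀) (𝓝 t₀) := by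
    simpa using (tendsto_id (x := 𝓝 t₀)).max (tendsto_const_nhds (x := t₀))
  have hfin : ∫⁻ s in Ico 0 (t₀ + 1), ∫⁻ x, lossRate k (g s) x ≠ ∞ := by
    rw [lintegral_lintegral_swap (f := fun s x => lossRate k (g s) x)
      (measurable_lossRate D.kernel.measurable D.measurable).aemeasurable]
    exact D.lintegral_loss_ne_top hf hT
  have hlim := tendsto_setLIntegral_Ico hfin (hmin.mono_left nhdsWithin_le_nhds)
    (hmax.mono_left (nhdsWithin_le_nhds (s := Ici 0)))
    (eventually_mem_nhdsWithin.mono fun t ht => le_min ht ht₀)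
    (nhdsWithin_le_nhds ((hmax.eventually (gt_mem_nhds (lt_add_one t₀))).mono fun _ h => h.le))
  have hlim2 := ENNReal.Tendsto.const_mul (a := 2) hlim (Or.inr (by simp))
  rw [mul_zero] at hlim2
  have hbound : ∀ t ≥ 0, ∫⁻ x in Ioi 0, ENNReal.ofReal |(g t x).toReal - (g t₀ x).toReal|
      ≤ 2 * ∫⁻ s in Ico (min t t₀) (max t t₀), ∫⁻ x, lossRate k (g s) x := by
    intro t ht
    rcases le_total t t₀ with h | h
    · simp only [abs_sub_comm (g t _).toReal, min_eq_left h, max_eq_right h]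
      exact D.lintegral_abs_sub_le hf ht h
    · rw [min_eq_right h, max_eq_left h]
      exact D.lintegral_abs_sub_le hf ht₀ h
  have hlim3 := tendsto_of_tendsto_of_tendsto_of_le_of_le' tendsto_const_nhds hlim2
    (Eventually.of_forall fun _ => zero_le) (eventually_mem_nhdsWithin.mono hbound)
  refine ((ENNReal.tendsto_toReal ENNReal.zero_ne_top).comp hlim3).congr fun t => ?_
  have h1 := D.measurable_slice t
  have h2 := D.measurable_slice t₀
  exact (integral_eq_lintegral_of_nonneg_ae (ae_of_all _ fun _ => abs_nonneg _)
    (by fun_prop)).symm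

lemma integrableOn_toReal_mul (D : IsDensitySolution k f₀ g) (hf : ∫⁻ x, f₀ x ≠ ∞)
    (hf' : ∫⁻ x, ENNReal.ofReal x * f₀ x ≠ ∞) {t : ℝ} (ht : 0 ≤ t) :
    IntegrableOn (fun x => (1 + x) * (g t x).toReal) (Ioi 0) ∧
      ∫ x in Ioi 0, (1 + x) * (g t x).toReal
        ≤ ((∫⁻ x, f₀ x) + ∫⁻ x, ENNReal.ofReal x * f₀ x).toReal := by
  have hgm := D.measurable_slice t
  have heq : EqOn (fun x => (1 + x) * (g t x).toReal)
      (fun x => (g t x + ENNReal.ofReal x * g t x).toReal) (Ioi 0) := fun x hx => by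
    have hx' := (mem_Ioi.1 hx).le
    simp only
    rw [ENNReal.toReal_add (D.ne_top t x) (ENNReal.mul_ne_top ENNReal.ofReal_ne_top (D.ne_top t x)),
      ENNReal.toReal_mul, ENNReal.toReal_ofReal hx']
    ring
  have hm : Measurable (fun x => g t x + ENNReal.ofReal x * g t x) := by fun_prop
  have hle : ∫⁻ x in Ioi 0, g t x + ENNReal.ofReal x * g t x
      ≤ (∫⁻ x, f₀ x) + ∫⁻ x, ENNReal.ofReal x * f₀ x := by
    refine (setLIntegral_le_lintegral _ _).trans ?_
    rw [lintegral_add_left hgm]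
    exact add_le_add (D.mass_le t ht) (D.moment_le t ht)
  have hlt : (∫⁻ x, f₀ x) + ∫⁻ x, ENNReal.ofReal x * f₀ x < ∞ :=
    ENNReal.add_lt_top.2 ⟨hf.lt_top, hf'.lt_top⟩
  have hfin := (hle.trans_lt hlt).ne
  constructor
  · rw [integrableOn_congr_fun heq measurableSet_Ioi]
    exact integrable_toReal_of_lintegral_ne_top hm.aemeasurable hfin
  · rw [setIntegral_congr_fun measurableSet_Ioi heq,
      integral_toReal hm.aemeasurable (ae_lt_top hm hfin)]
    exact ENNReal.toReal_mono hlt.ne hle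

lemma integral_moment_le (D : IsDensitySolution k f₀ g)
    (hf' : ∫⁻ x, ENNReal.ofReal x * f₀ x ≠ ∞) {t : ℝ} (ht : 0 ≤ t) :
    ∫ x in Ioi 0, x * (g t x).toReal ≤ (∫⁻ x, ENNReal.ofReal x * f₀ x).toReal := by
  have hgm := D.measurable_slice t
  have heq : EqOn (fun x => x * (g t x).toReal)
      (fun x => (ENNReal.ofReal x * g t x).toReal) (Ioi 0) := fun x hx => by
    simp only
    rw [ENNReal.toReal_mul, ENNReal.toReal_ofReal (mem_Ioi.1 hx).le]
  have hm : Measurable (fun x => ENNReal.ofReal x * g t x) := by fun_prop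
  have hle := (setLIntegral_le_lintegral (Ioi 0) _).trans (D.moment_le t ht)
  rw [setIntegral_congr_fun measurableSet_Ioi heq,
    integral_toReal hm.aemeasurable (ae_lt_top hm (hle.trans_lt hf'.lt_top).ne)]
  exact ENNReal.toReal_mono hf' hle

variable {K : ℝ → ℝ → ℝ}

lemma toReal_kernel_mul (hK : ∀ x > 0, ∀ y > 0, 0 ≤ K x y ∧ k (x, y) = ENNReal.ofReal (K x y))
    {x y : ℝ} (hx : 0 < x) (hy : 0 < y) (a b : ℝ≥0∞) :
    K x y * a.toReal * b.toReal = (k (x, y) * (a * b)).toReal := by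
  obtain ⟨h0, h⟩ := hK x hx y hy
  rw [h, ENNReal.toReal_mul, ENNReal.toReal_mul, ENNReal.toReal_ofReal h0, mul_assoc]

lemma integral_loss_eq (D : IsDensitySolution k f₀ g)
    (hK : ∀ x > 0, ∀ y > 0, 0 ≤ K x y ∧ k (x, y) = ENNReal.ofReal (K x y)) {t x : ℝ} (hx : 0 < x)
    (hfin : ∫⁻ s in Ico 0 t, lossRate k (g s) x < ∞) :
    ∫ s in Ioc 0 t, ∫ y in Ioi 0, K x y * (g s x).toReal * (g s y).toReal
      = (∫⁻ s in Ico 0 t, lossRate k (g s) x).toReal := by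
  have hkm := D.kernel.measurable
  rw [restrict_Ico_eq_restrict_Ioc] at hfin ⊢
  have hm : Measurable (fun s => lossRate k (g s) x) :=
    (measurable_lossRate hkm D.measurable).comp measurable_prodMk_right
  rw [← integral_toReal hm.aemeasurable (ae_lt_top hm hfin.ne)]
  refine integral_congr_ae ?_
  filter_upwards with s
  have hgm := D.measurable_slice s
  rw [setIntegral_congr_fun measurableSet_Ioi fun y hy => toReal_kernel_mul hK hx hy _ _,
    integral_toReal (by fun_prop), setLIntegral_eq_lintegral_of_zero fun y hy => ?_]
  · rfl
  · rw [D.eq_zero s y hy, mul_zero, mul_zero]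
  · filter_upwards [ae_restrict_mem measurableSet_Ioi] with y hy
    rw [(hK x hx y hy).2]
    exact (ENNReal.mul_ne_top ENNReal.ofReal_ne_top
      (ENNReal.mul_ne_top (D.ne_top s x) (D.ne_top s y))).lt_top

lemma integral_gain_eq (D : IsDensitySolution k f₀ g)
    (hK : ∀ x > 0, ∀ y > 0, 0 ≤ K x y ∧ k (x, y) = ENNReal.ofReal (K x y)) {t x : ℝ} (hx : 0 < x)
    (hfin : ∫⁻ s in Ico 0 t, gainRate k (g s) x < ∞) :
    ∫ s in Ioc 0 t, ∫ y in Ioi 0, K (x + y) y * (g s (x + y)).toReal * (g s y).toReal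
      = (∫⁻ s in Ico 0 t, gainRate k (g s) x).toReal := by
  have hkm := D.kernel.measurable
  rw [restrict_Ico_eq_restrict_Ioc] at hfin ⊢
  have hm : Measurable (fun s => gainRate k (g s) x) :=
    (measurable_gainRate hkm D.measurable).comp measurable_prodMk_right
  rw [← integral_toReal hm.aemeasurable (ae_lt_top hm hfin.ne)]
  refine integral_congr_ae ?_
  filter_upwards with s
  have hgm := D.measurable_slice s
  rw [setIntegral_congr_fun measurableSet_Ioi
      fun y hy => toReal_kernel_mul hK (add_pos hx (mem_Ioi.1 hy)) hy _ _,
    integral_toReal (by fun_prop), setLIntegral_eq_lintegral_of_zero fun y hy => ?_]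
  · rfl
  · rw [D.eq_zero s y hy, mul_zero, mul_zero]
  · filter_upwards [ae_restrict_mem measurableSet_Ioi] with y hy
    rw [(hK (x + y) (add_pos hx (mem_Ioi.1 hy)) y hy).2]
    exact (ENNReal.mul_ne_top ENNReal.ofReal_ne_top
      (ENNReal.mul_ne_top (D.ne_top s _) (D.ne_top s y))).lt_top

lemma integrableOn_collisions (D : IsDensitySolution k f₀ g)
    (hK : ∀ x > 0, ∀ y > 0, 0 ≤ K x y ∧ k (x, y) = ENNReal.ofReal (K x y)) {t x : ℝ} (hx : 0 < x)
    (hfin : ∫⁻ s in Ico 0 t, lossRate k (g s) x < ∞) :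
    IntegrableOn (fun p : ℝ × ℝ => K x p.1 * (g p.2 x).toReal * (g p.2 p.1).toReal)
      (Ioi 0 ×ˢ Ioc 0 t) := by
  have hkm := D.kernel.measurable
  have hm : Measurable (fun p : ℝ × ℝ => k (x, p.1) * (g p.2 x * g p.2 p.1)) := by
    have h1 : Measurable (fun p : ℝ × ℝ => g p.2 x) :=
      D.measurable.comp (measurable_snd.prodMk measurable_const)
    have h2 : Measurable (fun p : ℝ × ℝ => g p.2 p.1) := D.measurable.comp measurable_swap
    have h3 : Measurable (fun p : ℝ × ℝ => k (x, p.1)) :=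
      hkm.comp (measurable_const.prodMk measurable_fst)
    exact h3.mul (h1.mul h2)
  rw [integrableOn_congr_fun (fun p hp => toReal_kernel_mul hK hx hp.1 _ _)
    (measurableSet_Ioi.prod measurableSet_Ioc)]
  refine integrable_toReal_of_lintegral_ne_top hm.aemeasurable ?_
  rw [Measure.volume_eq_prod, ← Measure.prod_restrict, lintegral_prod_symm _ hm.aemeasurable,
    ← restrict_Ico_eq_restrict_Ioc]
  exact ((lintegral_mono fun s => setLIntegral_le_lintegral _ _).trans_lt hfin).ne

theorem isMildSolutionRBK (D : IsDensitySolution k f₀ g) (hf : ∫⁻ x, f₀ x ≠ ∞)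
    (hf' : ∫⁻ x, ENNReal.ofReal x * f₀ x ≠ ∞)
    (hK : ∀ x > 0, ∀ y > 0, 0 ≤ K x y ∧ k (x, y) = ENNReal.ofReal (K x y)) {φ : ℝ → ℝ}
    (hφ0 : ∀ x, 0 ≤ φ x)
    (hφ : ∀ᵐ x ∂(volume.restrict (Ioi 0)), f₀ x = ENNReal.ofReal (φ x)) :
    IsMildSolutionRBK K φ (fun x t => (g t x).toReal) := by
  refine ⟨(D.measurable.comp measurable_swap).ennreal_toReal, fun _ _ _ _ => ENNReal.toReal_nonneg,
    fun t₀ ht₀ => ?_, fun T _ => ⟨_, fun t ht => D.integrableOn_toReal_mul hf hf' ht.1⟩,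
    fun t ht => ?_, fun t ht => ?_⟩
  · exact D.tendsto_integral_abs_sub hf ht₀
  · filter_upwards [ae_restrict_of_ae (D.ae_loss_lt_top hf ht.le),
      ae_restrict_mem measurableSet_Ioi] with x h hx
    exact D.integrableOn_collisions hK hx h
  · filter_upwards [ae_restrict_of_ae (D.ae_loss_lt_top hf ht), D.ae_gain_lt_top hf ht,
      D.add_eq t ht, ae_restrict_mem measurableSet_Ioi, hφ] with x hL hG h hx hx0
    rw [D.integral_loss_eq hK hx hL, D.integral_gain_eq hK hx hG, eq_sub_iff_add_eq,
      ← ENNReal.toReal_add (D.ne_top t x) hL.ne, h, hx0,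
      ENNReal.toReal_add ENNReal.ofReal_ne_top hG.ne, ENNReal.toReal_ofReal (hφ0 x)]

end IsDensitySolution

/-- The extension by zero of a kernel on `(0,∞)²` to an `ℝ≥0∞`-valued kernel on `ℝ²`. -/
noncomputable def extendKernel (K : ℝ → ℝ → ℝ) : ℝ × ℝ → ℝ≥0∞ :=
  (Ioi 0 ×ˢ Ioi 0).indicator fun p => ENNReal.ofReal (K p.1 p.2)

section extendKernel

variable {K : ℝ → ℝ → ℝ}

lemma extendKernel_of_pos {x y : ℝ} (hx : 0 < x) (hy : 0 < y) :
    extendKernel K (x, y) = ENNReal.ofReal (K x y) :=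
  indicator_of_mem (mk_mem_prod hx hy) _

lemma extendKernel_ne_top (p : ℝ × ℝ) : extendKernel K p ≠ ∞ := by
  unfold extendKernel
  by_cases h : p ∈ Ioi (0 : ℝ) ×ˢ Ioi (0 : ℝ)
  · rw [indicator_of_mem h]
    exact ENNReal.ofReal_ne_top
  · rw [indicator_of_notMem h]
    exact ENNReal.zero_ne_top

lemma continuousOn_ofReal_kernel
    (hK : ContinuousOn (Function.uncurry K) (Ioi 0 ×ˢ Ioi 0)) :
    ContinuousOn (fun p : ℝ × ℝ => ENNReal.ofReal (K p.1 p.2)) (Ioi 0 ×ˢ Ioi 0) :=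
  ENNReal.continuous_ofReal.comp_continuousOn hK

lemma continuousOn_extendKernel (hK : ContinuousOn (Function.uncurry K) (Ioi 0 ×ˢ Ioi 0)) :
    ContinuousOn (extendKernel K) (Ioi 0 ×ˢ Ioi 0) :=
  (continuousOn_ofReal_kernel hK).congr fun _ hp => indicator_of_mem hp _

lemma isCollisionKernel_extendKernel
    (hK : ContinuousOn (Function.uncurry K) (Ioi 0 ×ˢ Ioi 0))
    (hsymm : ∀ x > 0, ∀ y > 0, K x y = K y x) : IsCollisionKernel (extendKernel K) where
  measurable := by
    classical
    unfold extendKernel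
    rw [← piecewise_eq_indicator]
    exact (continuousOn_ofReal_kernel hK).measurable_piecewise continuousOn_const
      (measurableSet_Ioi.prod measurableSet_Ioi)
  symm x y := by
    by_cases h : 0 < x ∧ 0 < y
    · rw [extendKernel_of_pos h.1 h.2, extendKernel_of_pos h.2 h.1, hsymm x h.1 y h.2]
    · have h1 : (x, y) ∉ Ioi (0 : ℝ) ×ˢ Ioi (0 : ℝ) := h
      have h2 : (y, x) ∉ Ioi (0 : ℝ) ×ˢ Ioi (0 : ℝ) := fun h' => h h'.symm
      rw [extendKernel, indicator_of_notMem h1, indicator_of_notMem h2]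
  eq_zero x _ hx := indicator_of_notMem (fun h => absurd h.1 (not_lt.2 hx)) _

end extendKernel

/-- An integrable initial datum has a measurable `ℝ≥0∞`-valued version supported in `(0,∞)`. -/
lemma exists_measurable_density {φ : ℝ → ℝ} (hφ0 : ∀ x, 0 ≤ φ x)
    (hφ : IntegrableOn (fun x => (1 + x) * φ x) (Ioi 0)) :
    ∃ F : ℝ → ℝ≥0∞, Measurable F ∧ ∫⁻ x, F x ≠ ∞ ∧ ∫⁻ x, ENNReal.ofReal x * F x ≠ ∞ ∧
      (∫⁻ x, ENNReal.ofReal x * F x).toReal = ∫ x in Ioi 0, x * φ x ∧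
      ∀ᵐ x ∂(volume.restrict (Ioi 0)), F x = ENNReal.ofReal (φ x) := by
  have hφm : AEMeasurable φ (volume.restrict (Ioi 0)) := by
    have h : AEMeasurable (fun x : ℝ => (1 + x)⁻¹ * ((1 + x) * φ x)) (volume.restrict (Ioi 0)) :=
      (by fun_prop : Measurable fun x : ℝ => (1 + x)⁻¹).aemeasurable.mul hφ.aemeasurable
    refine h.congr ?_
    filter_upwards [ae_restrict_mem measurableSet_Ioi] with x hx
    have : 1 + x ≠ 0 := (add_pos one_pos (mem_Ioi.1 hx)).ne'
    field_simp
  have hFm : Measurable (fun x => ENNReal.ofReal (hφm.mk φ x)) := by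
    have := hφm.measurable_mk
    fun_prop
  have hF : ∀ᵐ x ∂(volume.restrict (Ioi 0)),
      (Ioi 0).indicator (fun x => ENNReal.ofReal (hφm.mk φ x)) x = ENNReal.ofReal (φ x) := by
    filter_upwards [hφm.ae_eq_mk, ae_restrict_mem measurableSet_Ioi] with x h hx
    rw [indicator_of_mem hx, h]
  have hle : ∀ w : ℝ → ℝ, (∀ x > 0, 0 ≤ w x ∧ w x ≤ 1 + x) →
      ∫⁻ x in Ioi 0, ENNReal.ofReal (w x * φ x) ≠ ∞ := by
    intro w hw
    refine ((lintegral_mono_ae ?_).trans_lt hφ.lintegral_lt_top).ne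
    filter_upwards [ae_restrict_mem measurableSet_Ioi] with x hx
    exact ENNReal.ofReal_le_ofReal (mul_le_mul_of_nonneg_right (hw x hx).2 (hφ0 x))
  have hmom : ∫⁻ x, ENNReal.ofReal x * (Ioi 0).indicator (fun x => ENNReal.ofReal (hφm.mk φ x)) x
      = ∫⁻ x in Ioi 0, ENNReal.ofReal (x * φ x) := by
    rw [← setLIntegral_eq_lintegral_of_zero fun x hx => by
      rw [ENNReal.ofReal_of_nonpos hx, zero_mul]]
    refine lintegral_congr_ae ?_
    filter_upwards [hF, ae_restrict_mem measurableSet_Ioi] with x h hx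
    rw [h, ENNReal.ofReal_mul (mem_Ioi.1 hx).le]
  refine ⟨_, hFm.indicator measurableSet_Ioi, ?_, ?_, ?_, hF⟩
  · rw [lintegral_indicator measurableSet_Ioi]
    have := hle (fun _ => 1) fun x hx => ⟨zero_le_one, by linarith⟩
    rwa [lintegral_congr_ae (g := fun x => ENNReal.ofReal (hφm.mk φ x))] at this
    filter_upwards [hφm.ae_eq_mk] with x h
    rw [one_mul, h]
  · rw [hmom]
    exact hle (fun x => x) fun x hx => ⟨hx.le, by linarith⟩
  · rw [hmom, integral_eq_lintegral_of_nonneg_ae]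
    · filter_upwards [ae_restrict_mem measurableSet_Ioi] with x hx
      exact mul_nonneg (mem_Ioi.1 hx).le (hφ0 x)
    · exact (aemeasurable_id.mul hφm).aestronglyMeasurable

/-- Global existence of mild solutions for arbitrary continuous symmetric kernels. -/
theorem exists_isMildSolutionRBK {K : ℝ → ℝ → ℝ}
    (hK : ContinuousOn (Function.uncurry K) (Ioi 0 ×ˢ Ioi 0))
    (hsymm : ∀ x > 0, ∀ y > 0, K x y = K y x) (hK0 : ∀ x > 0, ∀ y > 0, 0 ≤ K x y)
    {φ : ℝ → ℝ} (hφ0 : ∀ x, 0 ≤ φ x) (hφ : IntegrableOn (fun x => (1 + x) * φ x) (Ioi 0)) :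
    ∃ f : ℝ → ℝ → ℝ, IsMildSolutionRBK K φ f ∧
      ∀ t ≥ (0 : ℝ), ∫ x in Ioi (0 : ℝ), x * f x t ≤ ∫ x in Ioi (0 : ℝ), x * φ x := by
  obtain ⟨F, hFm, hF1, hF2, hF3, hF⟩ := exists_measurable_density hφ0 hφ
  have hμ : IsFiniteMeasure (volume.withDensity F) := isFiniteMeasure_withDensity hF1
  obtain ⟨κ, W⟩ := exists_isWeakSolution (isCollisionKernel_extendKernel hK hsymm)
    extendKernel_ne_top (continuousOn_extendKernel hK) (volume.withDensity F) (by
      rw [lintegral_withDensity_eq_lintegral_mul _ hFm ENNReal.measurable_ofReal]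
      simpa only [Pi.mul_apply, mul_comm] using hF2)
  obtain ⟨g, D⟩ := W.exists_isDensitySolution hFm hF1
  refine ⟨_, D.isMildSolutionRBK hF1 hF2
    (fun x hx y hy => ⟨hK0 x hx y hy, extendKernel_of_pos hx hy⟩) hφ0 hF, fun t ht => ?_⟩
  exact (D.integral_moment_le hF2 ht).trans_eq hF3

/-- Existence of a mild solution to the continuous RBK coagulation equation for
product-type strictly subquadratic kernels, with non-increasing first moment. -/
theorem stmt_7 (K : ℝ → ℝ → ℝ) (r : ℝ → ℝ) (α : ℝ → ℝ → ℝ) (A : ℝ) (hA : 0 < A)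
    (hr : ContinuousOn r (Set.Ioi 0)) (hrnn : ∀ ς > (0:ℝ), 0 ≤ r ς)
    (hα : ContinuousOn (Function.uncurry α) (Set.Ioi 0 ×ˢ Set.Ioi 0))
    (hαnn : ∀ ς > (0:ℝ), ∀ ϱ > (0:ℝ), 0 ≤ α ς ϱ)
    (hαsym : ∀ ς ϱ, α ς ϱ = α ϱ ς)
    (hαr : ∀ ς ≥ (1:ℝ), ∀ ϱ ≥ (1:ℝ), α ς ϱ ≤ A * r ς * r ϱ)
    (hK : ∀ ς > (0:ℝ), ∀ ϱ > (0:ℝ), K ς ϱ = r ς * r ϱ + α ς ϱ)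
    (hKnn : ∀ ς > (0:ℝ), ∀ ϱ > (0:ℝ), 0 ≤ K ς ϱ)
    (hsub : ∀ R ≥ (1:ℝ), Filter.Tendsto
      (fun ϱ => ⨆ ς : Set.Ioc (0:ℝ) R, K ς ϱ / ϱ) Filter.atTop (nhds 0))
    (f₀ : ℝ → ℝ) (hf₀nn : ∀ ς, 0 ≤ f₀ ς)
    (hf₀ : IntegrableOn (fun ς => (1 + ς) * f₀ ς) (Set.Ioi 0)) :
    ∃ f : ℝ → ℝ → ℝ, IsMildSolutionRBK K f₀ f ∧
      ∀ τ ≥ (0:ℝ), ∫ ς in Set.Ioi (0:ℝ), ς * f ς τ ≤ ∫ ς in Set.Ioi (0:ℝ), ς * f₀ ς := by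
  have hc : ContinuousOn (Function.uncurry K) (Ioi 0 ×ˢ Ioi 0) := by
    have h : ContinuousOn (fun p : ℝ × ℝ => r p.1 * r p.2 + Function.uncurry α p)
        (Ioi 0 ×ˢ Ioi 0) :=
      ((hr.comp continuousOn_fst fun p hp => hp.1).mul
        (hr.comp continuousOn_snd fun p hp => hp.2)).add hα
    exact h.congr fun p hp => hK p.1 hp.1 p.2 hp.2
  refine exists_isMildSolutionRBK hc (fun x hx y hy => ?_) hKnn hf₀nn hf₀
  rw [hK x hx y hy, hK y hy x hx, hαsym, mul_comm]
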